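/- arXiv:2309.11434 — 4 statements merged into one kernel-verified Lean document; each statement's English description precedes it below -/
import Mathlib

section
/- Let T be a scheme and let f : Y → Y' be a morphism of schemes over T, where the structure morphism Y → T is proper and the structure morphism Y' → T is separated. Then f is a finite morphism if and only if for every point t ∈ T the induced morphism on fibers f_t : Y_t → Y'_t is finite. -/
/-!
STATEMENT 3.
Let `f : Y → Y'` be a morphism of schemes over `T`, with `Y → T` proper and `Y' → T`
separated.  Then `f` is finite iff for every point `t ∈ T` the induced morphism on
fibers `f_t : Y_t → Y'_t` is finite.
-/

open AlgebraicGeometry CategoryTheory CategoryTheory.Limits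

universe u

/-- The morphism induced by `f : Y ⟶ Y'` (a morphism over `T`) on scheme-theoretic fibers
over a point `t : T`, i.e. after base change along `Spec κ(t) ⟶ T`. -/
noncomputable def fiberMap {Y Y' T : Scheme.{u}} (f : Y ⟶ Y') (gY : Y ⟶ T) (gY' : Y' ⟶ T)
    (w : f ≫ gY' = gY) (t : T) :
    pullback gY (T.fromSpecResidueField t) ⟶ pullback gY' (T.fromSpecResidueField t) :=
  pullback.map gY (T.fromSpecResidueField t) gY' (T.fromSpecResidueField t) f (𝟙 _) (𝟙 _)
    (by rw [Category.comp_id, w]) (by simp)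

/-- The map induced on fibers over `t` is the base change of `f` along the inclusion of the
fiber of the target. -/
lemma isPullback_fiberMap {Y Y' T : Scheme.{u}} (f : Y ⟶ Y') (gY : Y ⟶ T) (gY' : Y' ⟶ T)
    (w : f ≫ gY' = gY) (t : T) :
    IsPullback (pullback.fst gY (T.fromSpecResidueField t)) (fiberMap f gY gY' w t)
      f (pullback.fst gY' (T.fromSpecResidueField t)) := by
  have hfst : fiberMap f gY gY' w t ≫ pullback.fst gY' (T.fromSpecResidueField t) =
      pullback.fst gY (T.fromSpecResidueField t) ≫ f :=
    pullback.lift_fst ..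
  have hsnd : fiberMap f gY gY' w t ≫ pullback.snd gY' (T.fromSpecResidueField t) =
      pullback.snd gY (T.fromSpecResidueField t) :=
    (pullback.lift_snd ..).trans (Category.comp_id _)
  refine .flip (.of_right ?_ hfst (IsPullback.of_hasPullback gY' (T.fromSpecResidueField t)).flip)
  rw [hsnd, w]
  exact (IsPullback.of_hasPullback gY (T.fromSpecResidueField t)).flip

/-- A morphism over `T` has finite set-theoretic fibers if all the morphisms it induces on fibers
over points of `T` do. -/
lemma finite_preimage_singleton_of_fiberMap {Y Y' T : Scheme.{u}} (f : Y ⟶ Y') (gY : Y ⟶ T)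
    (gY' : Y' ⟶ T) (w : f ≫ gY' = gY)
    (H : ∀ t z, ((fiberMap f gY gY' w t) ⁻¹' {z}).Finite) (y : Y') :
    (f ⁻¹' {y}).Finite := by
  refine ((H (gY' y) (gY'.asFiber y)).image (gY.fiberι (gY' y))).subset ?_
  rintro x rfl
  have hx : gY x = gY' (f x) := by rw [← w, Scheme.Hom.comp_apply]
  obtain ⟨x', hx'⟩ : x ∈ Set.range (gY.fiberι (gY' (f x))) := by
    rw [Scheme.Hom.range_fiberι]
    exact hx
  refine ⟨x', (gY'.fiberι (gY' (f x))).isEmbedding.injective ?_, hx'⟩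
  rw [Scheme.Hom.fiberι_asFiber]
  have h := congr($((isPullback_fiberMap f gY gY' w (gY' (f x))).w) x')
  exact h.symm.trans (congrArg f hx')

theorem statement_3 {Y Y' T : Scheme.{u}} (f : Y ⟶ Y') (gY : Y ⟶ T) (gY' : Y' ⟶ T)
    (w : f ≫ gY' = gY) [IsProper gY] [IsSeparated gY'] :
    IsFinite f ↔ ∀ t : T, IsFinite (fiberMap f gY gY' w t) := by
  refine ⟨fun _ t ↦ MorphismProperty.of_isPullback (P := @IsFinite)
    (isPullback_fiberMap f gY gY' w t) inferInstance, fun H ↦ ?_⟩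
  have : IsProper (f ≫ gY') := w ▸ inferInstance
  have : IsProper f := .of_comp f gY'
  have : LocallyQuasiFinite f := .of_finite_preimage_singleton f
    (finite_preimage_singleton_of_fiberMap f gY gY' w
      fun t z ↦ (fiberMap f gY gY' w t).finite_preimage_singleton z)
  exact .of_isProper_of_locallyQuasiFinite f
end

section
/- Let k be a field, let B be a finite type k-algebra, and let C be a flat, finite type algebra over B[t]/(t²). Fix nonnegative integers d and c. For a point s ∈ Spec B with residue field κ(s), set C_s := C ⊗_B κ(s), a finite type algebra over κ(s)[t]/(t²), and let Z_s := { x ∈ Spec C_s : dim_{κ(x)} (κ(x) ⊗_{C_s} Ω_{C_s/κ(s)}) ≥ d + 1 }, where κ(x) denotes the residue field of x and Ω_{C_s/κ(s)} is the module of Kähler differentials of C_s over κ(s). Then the set of points s ∈ Spec B such that every irreducible component of Z_s has codimension at least c + 1 in Spec C_s is a constructible subset of Spec B. -/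
/-!
STATEMENT 7.
Let `k` be a field, `B` a finite type `k`-algebra, and `C` a flat, finite type algebra
over `B[t]/(t²)`.  Fix `d c : ℕ`.  For `s ∈ Spec B` with residue field `κ(s)`, set
`C_s := C ⊗_B κ(s)` (written `κ(s) ⊗[B] C` in Mathlib's convention) and let
`Z_s := {x ∈ Spec C_s : dim_{κ(x)} (κ(x) ⊗_{C_s} Ω_{C_s/κ(s)}) ≥ d + 1}`.
Then the set of `s ∈ Spec B` such that every irreducible component of `Z_s` has
codimension at least `c + 1` in `Spec C_s` is a constructible subset of `Spec B`.
-/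

open TensorProduct IsLocalRing

/-- The ring `B[t]/(t²)`. -/
abbrev firstOrderBase (B : Type*) [CommRing B] : Type _ :=
  Polynomial B ⧸ Ideal.span {(Polynomial.X : Polynomial B) ^ 2}

/-- The locus `Z ⊆ Spec C` of points `x` with
`dim_{κ(x)} (κ(x) ⊗_C Ω_{C/F}) ≥ d + 1`. -/
noncomputable def kaehlerRankLocus (F C : Type*) [CommRing F] [CommRing C] [Algebra F C]
    (d : ℕ) : Set (PrimeSpectrum C) :=
  {x | d + 1 ≤ Module.finrank (ResidueField (Localization.AtPrime x.asIdeal))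
      ((ResidueField (Localization.AtPrime x.asIdeal)) ⊗[C] (KaehlerDifferential F C))}

/-- "Every irreducible component of `Z` has codimension at least `m` in `Spec C`."
The generic points of the irreducible components of a closed subset `Z ⊆ Spec C` are
exactly the minimal points of `Z` (with respect to the inclusion order on primes, which
is the specialization order), and the codimension of the irreducible component with
generic point `x` — the supremum of lengths of chains of irreducible closed subsets
between it and `Spec C` — equals `Order.height x` in the inclusion order. -/
def componentsCodimGE {C : Type*} [CommRing C] (Z : Set (PrimeSpectrum C)) (m : ℕ∞) :
    Prop :=
  ∀ x, Minimal (· ∈ Z) x → m ≤ Order.height x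

/-- A set is constructible if it is a finite union of locally closed sets
(intersections of an open and a closed set). -/
def IsConstructibleSet {X : Type*} [TopologicalSpace X] (s : Set X) : Prop :=
  ∃ (n : ℕ) (U Z : Fin n → Set X), (∀ i, IsOpen (U i)) ∧ (∀ i, IsClosed (Z i)) ∧
    s = ⋃ i, U i ∩ Z i

/-- The `A`-module `M` becomes flat after inverting `f`: for every ideal `I` of `A`, the kernel of
`I ⊗ M → A ⊗ M` is killed by powers of `f`. -/
def FlatAway {A : Type*} (M : Type*) [CommRing A] [AddCommGroup M] [Module A M] (f : A) : Prop :=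
  ∀ (I : Ideal A) (z : I ⊗[A] M), LinearMap.rTensor M I.subtype z = 0 → ∃ n : ℕ, f ^ n • z = 0

namespace FlatAway

variable {A M M' M'' : Type*} [CommRing A] [AddCommGroup M] [Module A M]
  [AddCommGroup M'] [Module A M'] [AddCommGroup M''] [Module A M'']

theorem of_dvd {f g : A} (h : FlatAway M f) (hfg : f ∣ g) : FlatAway M g := by
  obtain ⟨e, rfl⟩ := hfg
  intro I z hz
  obtain ⟨n, hn⟩ := h I z hz
  exact ⟨n, by rw [mul_pow, mul_comm, mul_smul, hn, smul_zero]⟩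

theorem of_flat [Module.Flat A M] (f : A) : FlatAway M f := fun I z hz =>
  ⟨0, by
    have := Module.Flat.rTensor_preserves_injective_linearMap (M := M) I.subtype
      I.subtype_injective
    rw [this (hz.trans (map_zero _).symm), smul_zero]⟩

theorem of_smul_eq_zero {f : A} (h : ∀ m : M, f • m = 0) : FlatAway M f := by
  intro I z _
  refine ⟨1, ?_⟩
  rw [pow_one]
  clear * - h
  induction z with
  | zero => simp
  | tmul x y => rw [← TensorProduct.tmul_smul, h, TensorProduct.tmul_zero]
  | add x y hx hy => rw [smul_add, hx, hy, add_zero]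

theorem rTensor_lTensor_comm (I : Ideal A) (l : M →ₗ[A] M') (w : I ⊗[A] M) :
    LinearMap.rTensor M' I.subtype (LinearMap.lTensor I l w) =
      LinearMap.lTensor A l (LinearMap.rTensor M I.subtype w) := by
  rw [← LinearMap.comp_apply, ← LinearMap.comp_apply, LinearMap.rTensor_comp_lTensor,
    LinearMap.lTensor_comp_rTensor]

theorem of_exact {f : A} (i : M' →ₗ[A] M) (p : M →ₗ[A] M'') (hi : Function.Injective i)
    (hp : Function.Surjective p) (hip : Function.Exact i p) (h' : FlatAway M' f)
    (h'' : FlatAway M'' f) : FlatAway M f := by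
  intro I z hz
  obtain ⟨n, hn⟩ := h'' I (LinearMap.lTensor I p z) (by
    rw [rTensor_lTensor_comm, hz, map_zero])
  rw [← map_smul] at hn
  obtain ⟨w, hw⟩ := (lTensor_exact I hip hp _).1 hn
  obtain ⟨m, hm⟩ := h' I w (by
    apply Module.Flat.lTensor_preserves_injective_linearMap (M := A) i hi
    rw [← rTensor_lTensor_comm, hw, map_smul, hz, smul_zero, map_zero])
  exact ⟨m + n, by rw [pow_add, mul_smul, ← hw, ← map_smul, hm, map_zero]⟩

theorem of_linearEquiv {f : A} (e : M ≃ₗ[A] M') (h : FlatAway M f) : FlatAway M' f :=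
  of_exact (M'' := PUnit.{1}) e.toLinearMap 0 e.injective (fun _ => ⟨0, Subsingleton.elim _ _⟩)
    (fun y => ⟨fun _ => ⟨e.symm y, by simp⟩, fun _ => rfl⟩) h (of_flat f)

theorem of_forall_mem {f : A} (F : ℕ → Submodule A M) (hF : Monotone F) (hF' : ∀ m, ∃ n, m ∈ F n)
    (h : ∀ n, FlatAway (F n) f) : FlatAway M f := by
  intro I z hz
  obtain ⟨n, w, rfl⟩ : ∃ n, ∃ w : I ⊗[A] F n, LinearMap.lTensor I (F n).subtype w = z := by
    clear hz
    induction z with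
    | zero => exact ⟨0, 0, by simp⟩
    | tmul x y =>
      obtain ⟨n, hn⟩ := hF' y
      exact ⟨n, x ⊗ₜ ⟨y, hn⟩, by simp⟩
    | add x y hx hy =>
      obtain ⟨n, v, rfl⟩ := hx
      obtain ⟨m, w, rfl⟩ := hy
      refine ⟨max n m, LinearMap.lTensor I (Submodule.inclusion (hF (le_max_left n m))) v +
        LinearMap.lTensor I (Submodule.inclusion (hF (le_max_right n m))) w, ?_⟩
      rw [map_add, ← LinearMap.comp_apply, ← LinearMap.comp_apply, ← LinearMap.lTensor_comp,
        ← LinearMap.lTensor_comp]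
      rfl
  obtain ⟨k, hk⟩ := h n I w (by
    apply Module.Flat.lTensor_preserves_injective_linearMap (M := A) (F n).subtype
      (F n).subtype_injective
    rw [map_zero, ← LinearMap.comp_apply, LinearMap.lTensor_comp_rTensor,
      ← LinearMap.rTensor_comp_lTensor, LinearMap.comp_apply, hz])
  exact ⟨k, by rw [← map_smul, hk, map_zero]⟩

theorem range_sup {D : Type*} [CommRing D] [Algebra A D] [Module D M] [Module D M']
    [IsScalarTower A D M] [IsScalarTower A D M'] {f : A} (q : M →ₗ[D] M') (P : Submodule D M')
    (hq : FlatAway (M ⧸ P.comap q) f) (hP : FlatAway P f) :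
    FlatAway ↥(LinearMap.range q ⊔ P) f := by
  have hle : P ≤ LinearMap.range q ⊔ P := le_sup_right
  have hq' (x : M) : q x ∈ LinearMap.range q ⊔ P := Submodule.mem_sup_left ⟨x, rfl⟩
  generalize hQ : LinearMap.range q ⊔ P = Q at hle hq'
  let r : M →ₗ[D] Q ⧸ P.submoduleOf Q := (P.submoduleOf Q).mkQ ∘ₗ q.codRestrict Q hq'
  have hr : Function.Surjective r := by
    intro y
    obtain ⟨⟨y, hy⟩, rfl⟩ := Submodule.mkQ_surjective _ y
    obtain ⟨_, ⟨x, rfl⟩, z, hz, hxz⟩ := Submodule.mem_sup.1 (hQ ▸ hy)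
    refine ⟨x, (Submodule.Quotient.eq _).2 ?_⟩
    have : q x - y = -z := by rw [← hxz]; abel
    simpa [Submodule.submoduleOf, this] using hz
  have hker : LinearMap.ker r = P.comap q := by
    ext x
    exact Submodule.Quotient.mk_eq_zero _
  let e : (M ⧸ P.comap q) ≃ₗ[D] Q ⧸ P.submoduleOf Q :=
    (Submodule.quotEquivOfEq _ _ hker).symm.trans (r.quotKerEquivOfSurjective hr)
  have h1 : FlatAway (Q ⧸ P.submoduleOf Q) f := hq.of_linearEquiv (e.restrictScalars A)
  let i : P →ₗ[A] Q := (Submodule.inclusion hle).restrictScalars A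
  let p : Q →ₗ[A] Q ⧸ P.submoduleOf Q := (P.submoduleOf Q).mkQ.restrictScalars A
  refine of_exact i p (Submodule.inclusion_injective hle)
    (Submodule.mkQ_surjective (P.submoduleOf Q)) (fun x => ?_) hP h1
  refine (Submodule.Quotient.mk_eq_zero _).trans ?_
  exact ⟨fun hx => ⟨⟨x, hx⟩, rfl⟩, fun ⟨y, hy⟩ => hy ▸ y.2⟩

/-- If `M` is flat away from `f` and `a` is injective on `N` with cokernel `M`, then `a` is
injective on `N / I N` up to powers of `f`. -/
theorem exists_pow_mul_mem_map {A D : Type*} [CommRing A] [CommRing D] [Algebra A D] {f : A} {a : D}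
    (ha : a ∈ nonZeroDivisors D) (h : FlatAway (D ⧸ Ideal.span {a}) f) (I : Ideal A) {d : D}
    (hd : a * d ∈ I.map (algebraMap A D)) :
    ∃ n : ℕ, algebraMap A D f ^ n * d ∈ I.map (algebraMap A D) := by
  have hmem (x : D) : x ∈ I.map (algebraMap A D) ↔
      ∃ z : I ⊗[A] D, TensorProduct.lid A D (LinearMap.rTensor D I.subtype z) = x := by
    rw [← Submodule.restrictScalars_mem A, ← Ideal.smul_top_eq_map,
      ← Submodule.map_range_rTensor_subtype_lid]
    simp only [Submodule.mem_map, LinearMap.mem_range, exists_exists_eq_and]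
    rfl
  let i : D →ₗ[A] D := LinearMap.mulLeft A a
  let p : D →ₗ[A] D ⧸ Ideal.span {a} := (Ideal.Quotient.mkₐ A (Ideal.span {a})).toLinearMap
  have hip : Function.Exact i p := fun x => by
    simp only [p, i, AlgHom.toLinearMap_apply, Ideal.Quotient.mkₐ_eq_mk,
      Ideal.Quotient.eq_zero_iff_mem, Ideal.mem_span_singleton', Set.mem_range,
      LinearMap.mulLeft_apply, mul_comm a]
  have hlid {M N : Type _} [AddCommGroup M] [Module A M] [AddCommGroup N] [Module A N]
      (l : M →ₗ[A] N) (w : A ⊗[A] M) :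
      TensorProduct.lid A N (LinearMap.lTensor A l w) = l (TensorProduct.lid A M w) := by
    induction w with
    | zero => simp
    | tmul x y => simp
    | add x y hx hy => simp only [map_add, hx, hy]
  obtain ⟨z, hz⟩ := (hmem _).1 hd
  obtain ⟨n, hn⟩ := h I (LinearMap.lTensor I p z) (by
    apply (TensorProduct.lid A _).injective
    rw [rTensor_lTensor_comm, hlid, hz, map_zero, hip (a * d)]
    exact ⟨d, rfl⟩)
  rw [← map_smul] at hn
  obtain ⟨w, hw⟩ := (lTensor_exact I hip Ideal.Quotient.mk_surjective _).1 hn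
  refine ⟨n, (hmem _).2 ⟨w, ?_⟩⟩
  rw [← mul_cancel_left_mem_nonZeroDivisors ha]
  have := congrArg (fun z => TensorProduct.lid A D (LinearMap.rTensor D I.subtype z)) hw
  rw [rTensor_lTensor_comm, hlid, map_smul, map_smul, hz] at this
  rw [← map_pow, mul_left_comm, ← Algebra.smul_def]
  exact this

end FlatAway

/-- Every finite `D`-module becomes flat over `A` after inverting a nonzero element of `A`. -/
def GenericallyFlat.{u, v, w} (A : Type u) (D : Type v) [CommRing A] [CommRing D]
    [Algebra A D] : Prop :=
  ∀ (M : Type w) [AddCommGroup M] [Module A M] [Module D M] [IsScalarTower A D M]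
    [Module.Finite D M], ∃ f : A, f ≠ 0 ∧ FlatAway M f

namespace GenericallyFlat

universe u v v' w

theorem self (A : Type u) [CommRing A] [IsDomain A] [IsNoetherianRing A] :
    GenericallyFlat.{u, u, w} A A := by
  intro M _ m₁ m₂ _ _
  obtain rfl : m₁ = m₂ := by
    ext r x
    have := @IsScalarTower.smul_assoc A A M _ m₂.toSMul m₁.toSMul _ r 1 x
    rw [smul_eq_mul, mul_one, @one_smul A M _ m₂.toMulAction] at this
    exact this.symm
  refine IsNoetherianRing.induction_on_isQuotientEquivQuotientPrime A ‹Module.Finite A M›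
    (motive := fun N _ _ _ => ∃ f : A, f ≠ 0 ∧ FlatAway N f) ?_ ?_ ?_
  · intro N _ _ _ _
    exact ⟨1, one_ne_zero, .of_flat _⟩
  · intro N _ _ _ p e
    by_cases hp : p.1 = ⊥
    · have : Module.Flat A N :=
        .of_linearEquiv (e.trans (Submodule.quotEquivOfEqBot p.1 hp))
      exact ⟨1, one_ne_zero, .of_flat _⟩
    · obtain ⟨f, hf, hf0⟩ := Submodule.exists_mem_ne_zero_of_ne_bot hp
      refine ⟨f, hf0, .of_smul_eq_zero fun m => e.injective ?_⟩
      obtain ⟨x, hx⟩ := Ideal.Quotient.mk_surjective (e m)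
      rw [map_smul, map_zero, ← hx, Algebra.smul_def, Ideal.Quotient.algebraMap_eq, ← map_mul,
        Ideal.Quotient.eq_zero_iff_mem]
      exact p.1.mul_mem_right _ hf
  · rintro N₁ _ _ _ N₂ _ _ _ N₃ _ _ _ i p hi hp hip ⟨f, hf, h₁⟩ ⟨g, hg, h₃⟩
    exact ⟨f * g, mul_ne_zero hf hg, .of_exact i p hi hp hip (h₁.of_dvd (dvd_mul_right _ _))
      (h₃.of_dvd (dvd_mul_left _ _))⟩

theorem of_surjective {A : Type u} {D : Type v} {D' : Type v'} [CommRing A] [CommRing D]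
    [CommRing D'] [Algebra A D] [Algebra A D'] (φ : D →ₐ[A] D') (hφ : Function.Surjective φ)
    (h : GenericallyFlat.{u, v, w} A D) : GenericallyFlat.{u, v', w} A D' := by
  intro M _ _ _ _ _
  let : Module D M := Module.compHom M φ.toRingHom
  let : Algebra D D' := φ.toRingHom.toAlgebra
  have : IsScalarTower D D' M := .of_algebraMap_smul fun _ _ => rfl
  have : IsScalarTower A D M := .of_algebraMap_smul fun r x => by
    change φ (algebraMap A D r) • x = r • x
    rw [φ.commutes, algebraMap_smul]
  have : Module.Finite D D' := .of_surjective (Algebra.linearMap D D') hφ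
  have : Module.Finite D M := .trans D' M
  exact h M

theorem exists_common {A : Type u} [CommRing A] [IsDomain A] (P : ℕ → A → Prop)
    (hP : ∀ i f g, P i f → f ∣ g → P i g) (h : ∀ i, ∃ f, f ≠ 0 ∧ P i f) (n : ℕ) :
    ∃ f, f ≠ 0 ∧ ∀ i ≤ n, P i f := by
  choose f hf hf' using h
  exact ⟨∏ i ∈ Finset.range (n + 1), f i, Finset.prod_ne_zero_iff.2 fun i _ => hf i, fun i hi =>
    hP _ _ _ (hf' i) (Finset.dvd_prod_of_mem _ (by simpa [Nat.lt_succ_iff] using hi))⟩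

theorem of_endomorphism {A : Type u} {D : Type v} {M : Type w} [CommRing A] [CommRing D]
    [Algebra A D] [IsDomain A] [IsNoetherianRing D] [AddCommGroup M] [Module A M] [Module D M]
    [IsScalarTower A D M] (h : GenericallyFlat.{u, v, w} A D) (φ : Module.End D M)
    (N : Submodule D M) (hN : N.FG)
    (hM : ∀ G : Submodule D M, N ≤ G → G.map φ ≤ G → G = ⊤) :
    ∃ f : A, f ≠ 0 ∧ FlatAway M f := by
  let F (i : ℕ) : Submodule D M := (Finset.range i).sup fun j => N.map (φ ^ j)
  have hF (i) : F (i + 1) = N.map (φ ^ i) ⊔ F i := by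
    simp only [F, Finset.range_add_one, Finset.sup_insert]
  have hFm : Monotone F := monotone_nat_of_le_succ fun i => hF i ▸ le_sup_right
  have hφF (i) : (F i).map φ ≤ F (i + 1) := by
    induction i with
    | zero => exact (Submodule.map_bot φ).trans_le bot_le
    | succ i ih =>
      rw [hF i, Submodule.map_sup, hF (i + 1), ← Submodule.map_comp, ← Module.End.mul_eq_comp,
        ← pow_succ']
      exact sup_le_sup_left ih _
  let K : ℕ →o Submodule D N :=
    ⟨fun i => (F i).comap ((φ ^ i).comp N.subtype), monotone_nat_of_le_succ fun i x hx => by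
      have := hφF i (Submodule.mem_map_of_mem hx)
      simpa [pow_succ'] using this⟩
  have : IsNoetherian D N := isNoetherian_of_fg_of_noetherian _ hN
  obtain ⟨i₀, hi₀⟩ := monotone_stabilizes_iff_noetherian.2 ‹IsNoetherian D N› K
  obtain ⟨f, hf, hKf⟩ := exists_common (fun i f => FlatAway (N ⧸ K i) f)
    (fun _ _ _ h => h.of_dvd) (fun i => h (N ⧸ K i)) i₀
  replace hKf (i) : FlatAway (N ⧸ K i) f := by
    rcases le_total i i₀ with hi | hi
    · exact hKf i hi
    · rw [← hi₀ i hi]; exact hKf i₀ le_rfl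
  have hFf (i) : FlatAway (F i) f := by
    induction i with
    | zero =>
      have : Subsingleton (F 0) := inferInstanceAs (Subsingleton (⊥ : Submodule D M))
      exact .of_smul_eq_zero (M := F 0) fun m => Subsingleton.elim _ _
    | succ i ih =>
      have hr : LinearMap.range ((φ ^ i).comp N.subtype) = N.map (φ ^ i) := by
        rw [LinearMap.range_comp, Submodule.range_subtype]
      rw [hF, ← hr]
      exact (hKf i).range_sup _ _ ih
  refine ⟨f, hf, .of_forall_mem (fun i => (F i).restrictScalars A) hFm (fun m => ?_) hFf⟩
  have htop : ⨆ i, F i = ⊤ := by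
    refine hM _ (le_iSup_of_le 1 ?_) ?_
    · rw [hF, pow_zero]
      exact (Submodule.map_id N).ge.trans le_sup_left
    · rw [Submodule.map_iSup]
      exact iSup_le fun i => (hφF i).trans (le_iSup F (i + 1))
  exact (Submodule.mem_iSup_of_directed F hFm.directed_le).1 (htop ▸ Submodule.mem_top)

theorem polynomial {A : Type u} {D : Type v} [CommRing A] [CommRing D] [Algebra A D] [IsDomain A]
    [IsNoetherianRing D] (h : GenericallyFlat.{u, v, w} A D) :
    GenericallyFlat.{u, v, w} A (Polynomial D) := by
  intro M _ _ _ _ _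
  let : Module D M := Module.compHom M (Polynomial.C (R := D))
  have : IsScalarTower D (Polynomial D) M := .of_algebraMap_smul fun _ _ => rfl
  have : IsScalarTower A D M := .of_algebraMap_smul fun r x => by
    change algebraMap A (Polynomial D) r • x = r • x
    rw [algebraMap_smul]
  obtain ⟨S, hS⟩ := ‹Module.Finite (Polynomial D) M›
  refine of_endomorphism h ((LinearMap.lsmul (Polynomial D) M Polynomial.X).restrictScalars D)
    (Submodule.span D S) ⟨S, rfl⟩ fun G hSG hG => ?_
  let G' : Submodule (Polynomial D) M :=
    { G with
      smul_mem' := fun p x hx => by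
        change p • x ∈ G
        induction p using Polynomial.induction_on with
        | C a => exact G.smul_mem a hx
        | add p q hp hq => rw [add_smul]; exact G.add_mem hp hq
        | monomial n a ih =>
          rw [pow_succ', mul_left_comm, mul_smul]
          exact hG (Submodule.mem_map_of_mem ih) }
  have hG' : G' = ⊤ := top_le_iff.1 (hS ▸ Submodule.span_le.2 fun x hx =>
    hSG (Submodule.subset_span hx))
  exact eq_top_iff.2 fun x _ => show x ∈ G' from hG' ▸ Submodule.mem_top

theorem mvPolynomial (A : Type u) [CommRing A] [IsDomain A] [IsNoetherianRing A] (n : ℕ) :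
    GenericallyFlat.{u, u, w} A (MvPolynomial (Fin n) A) := by
  induction n with
  | zero => exact of_surjective (Algebra.ofId A _) (MvPolynomial.C_surjective _) (self A)
  | succ n ih =>
    exact of_surjective ((MvPolynomial.finSuccEquiv A n).symm.restrictScalars A).toAlgHom
      (MvPolynomial.finSuccEquiv A n).symm.surjective ih.polynomial

/-- **Generic flatness**. -/
theorem of_finiteType (A : Type u) (D : Type v) [CommRing A] [CommRing D] [Algebra A D]
    [IsDomain A] [IsNoetherianRing A] [Algebra.FiniteType A D] : GenericallyFlat.{u, v, w} A D := by
  obtain ⟨n, φ, hφ⟩ := Algebra.FiniteType.iff_quotient_mvPolynomial''.1 ‹Algebra.FiniteType A D›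
  exact of_surjective φ hφ (mvPolynomial A n)

end GenericallyFlat

namespace PrimeSpectrum

theorem exists_lt_of_nonZeroDivisors {A D : Type*} [CommRing A] [IsDomain A] [IsNoetherianRing A]
    [CommRing D] [Algebra A D] [Algebra.FiniteType A D] {a : D} (ha : a ∈ nonZeroDivisors D) :
    ∃ f : A, f ≠ 0 ∧ ∀ x : PrimeSpectrum D, algebraMap A D f ∉ x.asIdeal → a ∈ x.asIdeal →
      ∃ y < x, y.comap (algebraMap A D) = x.comap (algebraMap A D) := by
  obtain ⟨f, hf, hflat⟩ := GenericallyFlat.of_finiteType A D (D ⧸ Ideal.span {a})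
  refine ⟨f, hf, fun x hfx hax => ?_⟩
  let J := (x.asIdeal.comap (algebraMap A D)).map (algebraMap A D)
  have hJ : J ≤ x.asIdeal := Ideal.map_comap_le
  have hpow (n : ℕ) : ∀ g, a ^ n * g ∈ J → ∃ m, algebraMap A D f ^ m * g ∈ J := by
    induction n with
    | zero => exact fun g hg => ⟨0, by simpa using hg⟩
    | succ n ih =>
      intro g hg
      rw [pow_succ, mul_assoc] at hg
      obtain ⟨m, hm⟩ := ih _ hg
      rw [mul_left_comm] at hm
      obtain ⟨k, hk⟩ := hflat.exists_pow_mul_mem_map ha _ hm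
      exact ⟨k + m, by rwa [pow_add, mul_assoc]⟩
  obtain ⟨P, hP, hJP, hdisj⟩ := J.exists_le_prime_disjoint (Submonoid.powers a ⊔ x.asIdeal.primeCompl)
    (Set.disjoint_left.2 fun z hz hz' => by
      obtain ⟨_, ⟨n, rfl⟩, g, hg, rfl⟩ := Submonoid.mem_sup.1 hz'
      obtain ⟨m, hm⟩ := hpow n g hz
      rcases x.2.mem_or_mem (hJ hm) with h | h
      · exact hfx (x.2.mem_of_pow_mem _ h)
      · exact hg h)
  have hPx : P ≤ x.asIdeal := fun z hz => by
    by_contra hzx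
    exact Set.disjoint_left.1 hdisj hz (Submonoid.mem_sup_right (S := Submonoid.powers a) hzx)
  have haP : a ∉ P := fun h => Set.disjoint_left.1 hdisj h
    (Submonoid.mem_sup_left (T := x.asIdeal.primeCompl) (Submonoid.mem_powers a))
  refine ⟨⟨P, hP⟩, lt_of_le_not_ge hPx fun h => haP (h hax), PrimeSpectrum.ext ?_⟩
  exact le_antisymm (Ideal.comap_mono hPx) (Ideal.map_le_iff_le_comap.1 hJP)

variable {B C : Type*} [CommRing B] [IsNoetherianRing B] [CommRing C] [Algebra B C]
  [Algebra.FiniteType B C]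

/-- Lying-below in fibres holds over a dense open subset. -/
theorem exists_lt_of_comap_eq {Q q : PrimeSpectrum C} (hQq : Q < q)
    (hp : Q.comap (algebraMap B C) = q.comap (algebraMap B C)) :
    ∃ f ∉ (q.comap (algebraMap B C)).asIdeal, ∀ x, q ≤ x →
      f ∉ (x.comap (algebraMap B C)).asIdeal →
      ∃ y < x, Q ≤ y ∧ y.comap (algebraMap B C) = x.comap (algebraMap B C) := by
  obtain ⟨a, haq, haQ⟩ := Set.exists_of_ssubset (show (Q.asIdeal : Set C) ⊂ q.asIdeal from hQq)
  rw [← hp]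
  let p := (Q.comap (algebraMap B C)).asIdeal
  have : Q.asIdeal.LiesOver p := ⟨rfl⟩
  have : Algebra.FiniteType B (C ⧸ Q.asIdeal) := inferInstance
  have : Algebra.FiniteType (B ⧸ p) (C ⧸ Q.asIdeal) :=
    .of_restrictScalars_finiteType B (B ⧸ p) (C ⧸ Q.asIdeal)
  obtain ⟨f, hf, H⟩ := exists_lt_of_nonZeroDivisors (A := B ⧸ p) (D := C ⧸ Q.asIdeal)
    (a := Ideal.Quotient.mk _ a) (mem_nonZeroDivisors_of_ne_zero (by
      rwa [Ne, Ideal.Quotient.eq_zero_iff_mem]))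
  obtain ⟨f, rfl⟩ := Ideal.Quotient.mk_surjective f
  rw [Ne, Ideal.Quotient.eq_zero_iff_mem] at hf
  refine ⟨f, hf, fun x hqx hfx => ?_⟩
  have hmem : x ∈ Set.range (comap (Ideal.Quotient.mk Q.asIdeal)) := by
    rw [range_comap_of_surjective _ _ Ideal.Quotient.mk_surjective, Ideal.mk_ker]
    exact (hQq.le.trans hqx :)
  obtain ⟨x, rfl⟩ := hmem
  obtain ⟨y, hy, hyx⟩ := H x hfx (hqx haq)
  refine ⟨y.comap (Ideal.Quotient.mk _), lt_of_le_not_ge (Ideal.comap_mono hy.le) fun h =>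
    hy.not_ge ?_, ?_, ?_⟩
  · exact (Ideal.comap_le_comap_iff_of_surjective _ Ideal.Quotient.mk_surjective _ _).1 h
  · change Q.asIdeal ≤ y.asIdeal.comap _
    exact Ideal.mk_ker.ge.trans (Ideal.comap_mono bot_le)
  · exact congrArg (comap (Ideal.Quotient.mk p)) hyx

end PrimeSpectrum

namespace PrimeSpectrum

section FiberHeight

variable (B : Type*) {C : Type*} [CommRing B] [CommRing C] [Algebra B C]

/-- The height of a prime in its fibre over `Spec B`. -/
noncomputable def fiberHeight (x : PrimeSpectrum C) : ℕ∞ :=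
  Order.height (⟨x, rfl⟩ : comap (algebraMap B C) ⁻¹' {comap (algebraMap B C) x})

variable {B}

theorem fiberHeight_eq_height {s : PrimeSpectrum B} (x : comap (algebraMap B C) ⁻¹' {s}) :
    fiberHeight B x.1 = Order.height x := by
  obtain ⟨x, rfl⟩ := x
  rfl

theorem height_preimageOrderIsoFiber {s : PrimeSpectrum B} (x : comap (algebraMap B C) ⁻¹' {s}) :
    Order.height (preimageOrderIsoFiber B C s x) = fiberHeight B x.1 := by
  rw [Order.height_orderIso, fiberHeight_eq_height]

theorem add_one_le_fiberHeight_iff {n : ℕ} {x : PrimeSpectrum C} :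
    (n + 1 : ℕ) ≤ fiberHeight B x ↔
      ∃ y < x, y.comap (algebraMap B C) = x.comap (algebraMap B C) ∧ n ≤ fiberHeight B y := by
  have := (Order.height_le_coe_iff (n := n)
    (x := (⟨x, rfl⟩ : comap (algebraMap B C) ⁻¹' {comap (algebraMap B C) x}))).not
  push Not at this
  rw [Nat.cast_add, Nat.cast_one, Order.add_one_le_iff_of_not_isMax (by simp), fiberHeight, this]
  constructor
  · rintro ⟨y, hy, hn⟩
    exact ⟨y.1, hy, y.2, by rwa [fiberHeight_eq_height]⟩
  · rintro ⟨y, hy, h, hn⟩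
    exact ⟨⟨y, h⟩, hy, by rwa [← fiberHeight_eq_height]⟩

theorem mem_preimageOrderIsoFiber_iff {s : PrimeSpectrum B} (x : comap (algebraMap B C) ⁻¹' {s})
    (c : C) : (1 : s.asIdeal.ResidueField) ⊗ₜ[B] c ∈ (preimageOrderIsoFiber B C s x).asIdeal ↔
      c ∈ x.1.asIdeal := by
  obtain ⟨y, rfl⟩ := (preimageOrderIsoFiber B C s).symm.surjective x
  rw [OrderIso.apply_symm_apply]
  rfl

theorem fiberHeight_le_iff [Algebra.FiniteType B C] {q : PrimeSpectrum C} {n : ℕ} :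
    fiberHeight B q ≤ n ↔ ∃ t : Finset C, t.card ≤ n ∧
      q.asIdeal ∈ ((q.comap (algebraMap B C)).asIdeal.map (algebraMap B C) ⊔
        Ideal.span (t : Set C)).minimalPrimes := by
  classical
  generalize hp : q.comap (algebraMap B C) = p
  let e := preimageOrderIsoFiber B C p
  let q₀ : comap (algebraMap B C) ⁻¹' {p} := ⟨q, hp⟩
  have : IsNoetherianRing (p.asIdeal.Fiber C) :=
    Algebra.FiniteType.isNoetherianRing p.asIdeal.ResidueField _
  have hpq : p.asIdeal.map (algebraMap B C) ≤ q.asIdeal := by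
    rw [Ideal.map_le_iff_le_comap, ← hp]
    exact le_rfl
  have hh : fiberHeight B q = (e q₀).asIdeal.height := by
    rw [height_eq_orderHeight]
    exact (height_preimageOrderIsoFiber q₀).symm
  rw [hh]
  constructor
  · intro h
    obtain ⟨t, ht, hcard⟩ := Ideal.exists_finset_card_eq_height_of_isNoetherianRing (e q₀).asIdeal
    rw [← hcard, Nat.cast_le] at h
    choose r hr c hc using Ideal.Fiber.exists_smul_eq_one_tmul (S := C) p.asIdeal
    have key (x : comap (algebraMap B C) ⁻¹' {p}) (z : p.asIdeal.Fiber C) :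
        z ∈ (e x).asIdeal ↔ c z ∈ x.1.asIdeal := by
      rw [← mem_preimageOrderIsoFiber_iff, ← hc, Algebra.smul_def]
      refine (Ideal.IsPrime.mul_mem_left_iff fun h => hr z ?_).symm
      have h' : (1 : p.asIdeal.ResidueField) ⊗ₜ[B] algebraMap B C (r z) ∈ (e x).asIdeal := by
        rwa [← Algebra.TensorProduct.includeRight_apply, AlgHom.commutes]
      rw [mem_preimageOrderIsoFiber_iff] at h'
      have : r z ∈ (comap (algebraMap B C) x.1).asIdeal := h'
      rwa [x.2] at this
    refine ⟨t.image c, Finset.card_image_le.trans h, ⟨q.2, sup_le hpq (Ideal.span_le.2 ?_)⟩, ?_⟩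
    · intro _ hz
      obtain ⟨z, hzt, rfl⟩ := Finset.mem_image.1 hz
      exact (key q₀ z).1 (ht.1.2 (Ideal.subset_span hzt))
    · rintro q' ⟨hq', hle⟩ hq'q
      let x : comap (algebraMap B C) ⁻¹' {p} := ⟨⟨q', hq'⟩, PrimeSpectrum.ext (le_antisymm
        ((Ideal.comap_mono hq'q).trans (congrArg asIdeal hp).le)
        (Ideal.map_le_iff_le_comap.1 (le_sup_left.trans hle)))⟩
      have hx : e x ≤ e q₀ := e.monotone hq'q
      have := ht.2 ⟨(e x).2, Ideal.span_le.2 fun z hz => (key x z).2 (hle (Ideal.mem_sup_right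
        (Ideal.subset_span (Finset.mem_image_of_mem c hz))))⟩ hx
      exact e.le_iff_le.1 (show e q₀ ≤ e x from this)
  · rintro ⟨t, ht, hmin⟩
    refine (Ideal.height_le_card_of_mem_minimalPrimes_span_finset
      (s := t.image fun c => (1 : p.asIdeal.ResidueField) ⊗ₜ[B] c)
      ⟨⟨(e q₀).2, Ideal.span_le.2 ?_⟩, ?_⟩).trans
      (Nat.cast_le.2 (Finset.card_image_le.trans ht))
    · intro _ hz
      obtain ⟨z, hzt, rfl⟩ := Finset.mem_image.1 hz
      exact (mem_preimageOrderIsoFiber_iff q₀ z).2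
        (hmin.1.2 (Ideal.mem_sup_right (Ideal.subset_span hzt)))
    · rintro P ⟨hP, hle⟩ hPq
      obtain ⟨x, hx⟩ := e.surjective ⟨P, hP⟩
      obtain rfl : P = (e x).asIdeal := by rw [hx]
      have hxq : x ≤ q₀ := e.le_iff_le.1 hPq
      refine e.monotone (show q₀ ≤ x from hmin.2 ⟨x.1.2, sup_le ?_ (Ideal.span_le.2 ?_)⟩ hxq)
      · rw [Ideal.map_le_iff_le_comap]
        exact (congrArg asIdeal x.2).ge
      · exact fun z hz => (mem_preimageOrderIsoFiber_iff x z).1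
          (hle (Ideal.subset_span (Finset.mem_image_of_mem _ hz)))

end FiberHeight

variable {B C : Type*} [CommRing B] [IsNoetherianRing B] [CommRing C] [Algebra B C]
  [Algebra.FiniteType B C]

theorem exists_le_fiberHeight {n : ℕ} {q : PrimeSpectrum C} (hn : n ≤ fiberHeight B q) :
    ∃ f ∉ (q.comap (algebraMap B C)).asIdeal, ∀ x, q ≤ x →
      f ∉ (x.comap (algebraMap B C)).asIdeal → n ≤ fiberHeight B x := by
  induction n generalizing q with
  | zero => exact ⟨1, (Ideal.ne_top_iff_one _).1 (q.comap _).2.ne_top, fun _ _ _ => by simp⟩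
  | succ n ih =>
    obtain ⟨Q, hQq, hQ, hn⟩ := add_one_le_fiberHeight_iff.1 hn
    obtain ⟨f, hf, h⟩ := exists_lt_of_comap_eq hQq hQ
    obtain ⟨g, hg, h'⟩ := ih hn
    rw [hQ] at hg
    refine ⟨f * g, (q.comap _).2.mul_notMem hf hg, fun x hqx hx => ?_⟩
    obtain ⟨y, hyx, hQy, hy⟩ := h x hqx fun h => hx (Ideal.mul_mem_right _ _ h)
    exact add_one_le_fiberHeight_iff.2 ⟨y, hyx, hy, h' y hQy fun h =>
      hx (Ideal.mul_mem_left _ _ (hy ▸ h))⟩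

end PrimeSpectrum

namespace PrimeSpectrum

theorem exists_notMem_of_isConstructible {B : Type*} [CommRing B] {T : Set (PrimeSpectrum B)}
    (hT : Topology.IsConstructible T) {p : PrimeSpectrum B} (hp : p ∈ T) :
    ∃ f ∉ p.asIdeal, ∀ s, p ≤ s → f ∉ s.asIdeal → s ∈ T := by
  obtain ⟨S, rfl⟩ := exists_constructibleSetData_iff.2 hT
  obtain ⟨c, hc, hpc⟩ := Set.mem_iUnion₂.1 hp
  refine ⟨c.f, fun h => hpc.2 (Set.singleton_subset_iff.2 h), fun s hs hf =>
    Set.mem_iUnion₂.2 ⟨c, hc, Set.Subset.trans hpc.1 hs, fun h => hf (h rfl)⟩⟩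

theorem isConstructible_of_isClosed {C : Type*} [CommRing C] [IsNoetherianRing C]
    {T : Set (PrimeSpectrum C)} (hT : IsClosed T) : Topology.IsConstructible T :=
  Topology.IsConstructible.of_compl
    ((TopologicalSpace.NoetherianSpace.isCompact _).isConstructible hT.isOpen_compl)

variable {B C : Type*} [CommRing B] [IsNoetherianRing B] [CommRing C] [Algebra B C]
  [Algebra.FiniteType B C]

theorem exists_fiberHeight_le {n : ℕ} {q : PrimeSpectrum C} (hn : fiberHeight B q ≤ n) :
    ∃ f ∉ (q.comap (algebraMap B C)).asIdeal, ∀ s, q.comap (algebraMap B C) ≤ s →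
      f ∉ s.asIdeal → ∃ x, q ≤ x ∧ x.comap (algebraMap B C) = s ∧ fiberHeight B x ≤ n := by
  classical
  have : IsNoetherianRing C := Algebra.FiniteType.isNoetherianRing B C
  obtain ⟨t, ht, hq⟩ := fiberHeight_le_iff.1 hn
  set p := q.comap (algebraMap B C)
  set J := p.asIdeal.map (algebraMap B C) ⊔ Ideal.span (t : Set C)
  obtain ⟨g, hg, hgq⟩ : ∃ g ∉ q.asIdeal, ∀ P ∈ J.minimalPrimes, P ≠ q.asIdeal → g ∈ P := by
    let F := (J.finite_minimalPrimes_of_isNoetherianRing C).toFinset.erase q.asIdeal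
    have : ¬ F.inf id ≤ q.asIdeal := by
      rw [Ideal.IsPrime.inf_le' q.2]
      rintro ⟨P, hP, hPq⟩
      obtain ⟨hne, hP⟩ := Finset.mem_erase.1 hP
      rw [Set.Finite.mem_toFinset] at hP
      exact hne (le_antisymm hPq (hq.2 hP.1 hPq))
    obtain ⟨g, hg, hgq⟩ := SetLike.not_le_iff_exists.1 this
    exact ⟨g, hgq, fun P hP hne => (Finset.inf_le (f := id) (Finset.mem_erase.2
      ⟨hne, (Set.Finite.mem_toFinset _).2 hP⟩) : F.inf id ≤ P) hg⟩
  have hpres : (algebraMap B C).FinitePresentation :=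
    RingHom.finitePresentation_algebraMap.2 (Algebra.FinitePresentation.of_finiteType.1 ‹_›)
  have hT := isConstructible_comap_image hpres
    ((isConstructible_of_isClosed (isClosed_zeroLocus (q.asIdeal : Set C))).sdiff
      (isConstructible_of_isClosed (isClosed_zeroLocus {g})))
  obtain ⟨f, hf, H⟩ := exists_notMem_of_isConstructible (p := p) hT
    ⟨q, ⟨Set.Subset.rfl, fun h => hg (h rfl)⟩, rfl⟩
  refine ⟨f, hf, fun s hps hfs => ?_⟩
  obtain ⟨x₀, ⟨hqx₀, hgx₀⟩, rfl⟩ := H s hps hfs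
  replace hqx₀ : q ≤ x₀ := hqx₀
  replace hgx₀ : g ∉ x₀.asIdeal := fun h => hgx₀ (Set.singleton_subset_iff.2 h)
  set s := comap (algebraMap B C) x₀
  obtain ⟨P, hP, hPx₀⟩ := Ideal.exists_minimalPrimes_le
    (I := q.asIdeal ⊔ s.asIdeal.map (algebraMap B C)) (J := x₀.asIdeal)
    (sup_le hqx₀ Ideal.map_comap_le)
  let x : PrimeSpectrum C := ⟨P, hP.1.1⟩
  have hxs : x.comap (algebraMap B C) = s := PrimeSpectrum.ext (le_antisymm
    (Ideal.comap_mono hPx₀) (Ideal.map_le_iff_le_comap.1 (le_sup_right.trans hP.1.2)))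
  have hqx : q ≤ x := le_sup_left.trans hP.1.2
  refine ⟨x, hqx, hxs, fiberHeight_le_iff.2 ⟨t, ht, ?_⟩⟩
  rw [hxs]
  refine ⟨⟨hP.1.1, sup_le (le_sup_right.trans hP.1.2)
    (le_sup_right.trans (hq.1.2.trans hqx))⟩, ?_⟩
  rintro Q ⟨hQ, hle⟩ hQP
  have hJQ : J ≤ Q := (sup_le_sup_right (Ideal.map_mono hps) _).trans hle
  obtain ⟨Q₀, hQ₀, hQ₀Q⟩ := Ideal.exists_minimalPrimes_le hJQ
  have : Q₀ = q.asIdeal := by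
    by_contra h
    exact hgx₀ (hPx₀ (hQP (hQ₀Q (hgq _ hQ₀ h))))
  exact hP.2 ⟨hQ, sup_le (this ▸ hQ₀Q) (le_sup_left.trans hle)⟩ hQP

end PrimeSpectrum

namespace PrimeSpectrum

theorem isConstructibleSet_of_isConstructible {B : Type*} [CommRing B] {T : Set (PrimeSpectrum B)}
    (hT : Topology.IsConstructible T) : IsConstructibleSet T := by
  obtain ⟨S, rfl⟩ := exists_constructibleSetData_iff.2 hT
  refine ⟨S.card, fun i => (zeroLocus {(S.equivFin.symm i).1.f})ᶜ,
    fun i => zeroLocus (Set.range (S.equivFin.symm i).1.g),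
    fun i => (isClosed_zeroLocus _).isOpen_compl, fun i => isClosed_zeroLocus _, ?_⟩
  rw [S.equivFin.symm.surjective.iUnion_comp fun c : S =>
    (zeroLocus {c.1.f})ᶜ ∩ zeroLocus (Set.range c.1.g), ConstructibleSetData.toSet,
    ← Set.iUnion_subtype (p := (· ∈ S)) (s := fun c => c.1.toSet)]
  exact Set.iUnion_congr fun c => Set.inter_comm _ _

theorem isConstructible_of_forall_exists {B : Type*} [CommRing B] [IsNoetherianRing B]
    {E : Set (PrimeSpectrum B)} (h : ∀ p : PrimeSpectrum B, ∃ f ∉ p.asIdeal,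
      (∀ s, p ≤ s → f ∉ s.asIdeal → s ∈ E) ∨ (∀ s, p ≤ s → f ∉ s.asIdeal → s ∉ E)) :
    Topology.IsConstructible E := by
  suffices ∀ I : Ideal B, Topology.IsConstructible (E ∩ zeroLocus I) by
    simpa using this ⊥
  intro I
  induction I using WellFoundedGT.induction with
  | ind I ih =>
  have hlt {a : B} (ha : a ∉ I) : I < I ⊔ Ideal.span {a} :=
    left_lt_sup.2 fun h => ha (h (Ideal.mem_span_singleton_self a))
  by_cases hI : I.IsPrime
  · obtain ⟨f, hf, H⟩ := h ⟨I, hI⟩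
    have hsplit : E ∩ zeroLocus I =
        (E ∩ zeroLocus (I ⊔ Ideal.span {f} : Ideal B)) ∪ (E ∩ (zeroLocus I \ zeroLocus {f})) := by
      rw [zeroLocus_sup, zeroLocus_span, ← Set.inter_union_distrib_left, Set.inter_union_sdiff]
    rw [hsplit]
    refine (ih _ (hlt hf)).union ?_
    rcases H with H | H
    · rw [Set.inter_eq_right.2 fun s hs => H s hs.1 fun h => hs.2 (Set.singleton_subset_iff.2 h)]
      exact (isConstructible_of_isClosed (isClosed_zeroLocus _)).sdiff
        (isConstructible_of_isClosed (isClosed_zeroLocus _))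
    · rw [(Set.disjoint_left.2 fun s hsE hs => H s hs.1 (fun h => hs.2
        (Set.singleton_subset_iff.2 h)) hsE : Disjoint E _).inter_eq]
      exact .empty
  · rcases Ideal.not_isPrime_iff.1 hI with rfl | ⟨a, ha, b, hb, hab⟩
    · simp
    · have hsplit : E ∩ zeroLocus I = (E ∩ zeroLocus (I ⊔ Ideal.span {a} : Ideal B)) ∪
          (E ∩ zeroLocus (I ⊔ Ideal.span {b} : Ideal B)) := by
        have : zeroLocus (I : Set B) ⊆ zeroLocus {a} ∪ zeroLocus {b} := fun s hs =>
          (s.2.mem_or_mem (hs hab)).imp Set.singleton_subset_iff.2 Set.singleton_subset_iff.2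
        rw [zeroLocus_sup, zeroLocus_span, zeroLocus_sup, zeroLocus_span,
          ← Set.inter_union_distrib_left, ← Set.inter_union_distrib_left,
          Set.inter_eq_left.2 this]
      rw [hsplit]
      exact (ih _ (hlt ha)).union (ih _ (hlt hb))

theorem isConstructible_setOf_add_one_le_fiberHeight {B C : Type*} [CommRing B] [IsNoetherianRing B]
    [CommRing C] [Algebra B C] [Algebra.FiniteType B C] {Z : Set (PrimeSpectrum C)}
    (hZ : IsClosed Z) (n : ℕ) :
    Topology.IsConstructible {s : PrimeSpectrum B | ∀ x ∈ Z, x.comap (algebraMap B C) = s →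
      (n + 1 : ℕ) ≤ fiberHeight B x} := by
  classical
  have : IsNoetherianRing C := Algebra.FiniteType.isNoetherianRing B C
  obtain ⟨I, rfl⟩ := (isClosed_iff_zeroLocus_ideal _).1 hZ
  refine isConstructible_of_forall_exists fun p => ?_
  by_cases hp : ∀ x ∈ zeroLocus (I : Set C), x.comap (algebraMap B C) = p →
      (n + 1 : ℕ) ≤ fiberHeight B x
  · let J := I ⊔ p.asIdeal.map (algebraMap B C)
    have key (Q : Ideal C) : ∃ f ∉ p.asIdeal, Q ∈ J.minimalPrimes → ∀ x : PrimeSpectrum C,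
        Q ≤ x.asIdeal → f ∉ (x.comap (algebraMap B C)).asIdeal → (n + 1 : ℕ) ≤ fiberHeight B x := by
      by_cases hQ : Q ∈ J.minimalPrimes
      · let q : PrimeSpectrum C := ⟨Q, hQ.1.1⟩
        have hpq : p ≤ q.comap (algebraMap B C) :=
          Ideal.map_le_iff_le_comap.1 (le_sup_right.trans hQ.1.2)
        by_cases hqp : q.comap (algebraMap B C) ≤ p
        · have hqp := le_antisymm hqp hpq
          obtain ⟨f, hf, h⟩ := exists_le_fiberHeight (hp q (le_sup_left.trans hQ.1.2) hqp)
          exact ⟨f, hqp ▸ hf, fun _ => h⟩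
        · obtain ⟨f, hfq, hfp⟩ :=
            SetLike.not_le_iff_exists.1
            (show ¬ (q.comap (algebraMap B C)).asIdeal ≤ p.asIdeal from hqp)
          exact ⟨f, hfp, fun _ x hx hfx => (hfx (hx hfq)).elim⟩
      · exact ⟨1, (Ideal.ne_top_iff_one _).1 p.2.ne_top, fun h => (hQ h).elim⟩
    choose f hf H using key
    let S := (J.finite_minimalPrimes_of_isNoetherianRing C).toFinset
    refine ⟨∏ Q ∈ S, f Q, fun h => ?_, .inl fun s hps hs x hxI hxs => ?_⟩
    · obtain ⟨Q, _, hQ⟩ := (Ideal.IsPrime.prod_mem_iff (hp := p.2)).1 h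
      exact hf Q hQ
    · subst hxs
      obtain ⟨Q, hQ, hQx⟩ := Ideal.exists_minimalPrimes_le (I := J) (J := x.asIdeal)
        (sup_le hxI (Ideal.map_le_iff_le_comap.2 hps))
      exact H Q hQ x hQx fun h => hs (Ideal.mem_of_dvd _
        (Finset.dvd_prod_of_mem f ((Set.Finite.mem_toFinset _).2 hQ)) h)
  · push Not at hp
    obtain ⟨q, hqI, rfl, hq⟩ := hp
    obtain ⟨f, hf, H⟩ := exists_fiberHeight_le (Order.le_of_lt_add_one (by simpa using hq) :
      fiberHeight B q ≤ n)
    refine ⟨f, hf, .inr fun s hps hs h => ?_⟩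
    obtain ⟨x, hqx, hxs, hx⟩ := H s hps hs
    have := (h x (Set.Subset.trans hqI hqx) hxs).trans hx
    exact absurd (Nat.cast_le.1 this) (by simp)

end PrimeSpectrum

theorem Submodule.baseChange_eq_top_iff {R M : Type*} (A : Type*) [CommRing R] [CommRing A]
    [Algebra R A] [AddCommGroup M] [Module R M] (N : Submodule R M) :
    N.baseChange A = ⊤ ↔ Subsingleton (A ⊗[R] (M ⧸ N)) := by
  have hex : Function.Exact (N.subtype.baseChange A) (N.mkQ.baseChange A) :=
    lTensor_exact A (LinearMap.exact_subtype_mkQ N) N.mkQ_surjective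
  have hsurj : Function.Surjective (N.mkQ.baseChange A) :=
    LinearMap.lTensor_surjective A N.mkQ_surjective
  rw [Submodule.baseChange, ← hex.linearMap_ker_eq, LinearMap.ker_eq_top]
  refine ⟨fun h => subsingleton_of_forall_eq 0 fun y => ?_, fun h => Subsingleton.elim _ _⟩
  obtain ⟨x, rfl⟩ := hsurj y
  rw [h, LinearMap.zero_apply]

theorem TensorProduct.finrank_le_iff_exists_baseChange_eq_top {R M : Type*} (K : Type*)
    [CommRing R] [Field K] [Algebra R K] [AddCommGroup M] [Module R M] [Module.Finite R M]
    {n : ℕ} : Module.finrank K (K ⊗[R] M) ≤ n ↔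
      ∃ t : Finset M, t.card ≤ n ∧ (Submodule.span R (t : Set M)).baseChange K = ⊤ := by
  classical
  constructor
  · intro h
    obtain ⟨b, hb, hspan, hli⟩ := exists_linearIndependent K (Set.range (TensorProduct.mk R K M 1))
    have htop : Submodule.span K b = ⊤ := by
      rw [hspan, ← Set.image_univ, ← Submodule.baseChange_span, Submodule.span_univ,
        Submodule.baseChange_top]
    have : Fintype b := hli.setFinite.fintype
    choose v hv using fun x : b => hb x.2
    refine ⟨Finset.univ.image v, ?_, ?_⟩
    · refine Finset.card_image_le.trans ?_
      rw [Finset.card_univ]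
      exact hli.fintype_card_le_finrank.trans h
    · rw [Submodule.baseChange_span, eq_top_iff, ← htop]
      refine Submodule.span_mono fun x hx => ⟨v ⟨x, hx⟩, by simp, hv ⟨x, hx⟩⟩
  · rintro ⟨t, ht, htop⟩
    rw [Submodule.baseChange_span, ← Finset.coe_image] at htop
    rw [← finrank_top, ← htop]
    exact (finrank_span_finset_le_card _).trans (Finset.card_image_le.trans ht)

namespace PrimeSpectrum

theorem isClosed_setOf_le_finrank_residueField_tensorProduct {C : Type*} [CommRing C]
    (M : Type*) [AddCommGroup M] [Module C M] [Module.Finite C M] (n : ℕ) :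
    IsClosed {x : PrimeSpectrum C |
      n + 1 ≤ Module.finrank x.asIdeal.ResidueField (x.asIdeal.ResidueField ⊗[C] M)} := by
  have : {x : PrimeSpectrum C |
      n + 1 ≤ Module.finrank x.asIdeal.ResidueField (x.asIdeal.ResidueField ⊗[C] M)} =
      ⋂ t : {t : Finset M // t.card ≤ n},
        Module.support C (M ⧸ Submodule.span C (t.1 : Set M)) := by
    ext x
    rw [Set.mem_ofPred_eq, Nat.succ_le_iff, ← not_le,
      TensorProduct.finrank_le_iff_exists_baseChange_eq_top]
    simp [-Submodule.baseChange_span, Submodule.baseChange_eq_top_iff, not_subsingleton_iff_nontrivial,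
      Module.mem_support_iff_nontrivial_residueField_tensorProduct]
  rw [this]
  exact isClosed_iInter fun t => Module.isClosed_support

end PrimeSpectrum

theorem TensorProduct.finrank_tensorProduct_eq {C : Type*} (K L M : Type*) [CommRing C] [Field K]
    [Field L] [Algebra C K] [Algebra C L] [Algebra K L] [IsScalarTower C K L] [AddCommGroup M]
    [Module C M] : Module.finrank L (L ⊗[C] M) = Module.finrank K (K ⊗[C] M) := by
  rw [← (AlgebraTensorModule.cancelBaseChange C K L L M).finrank_eq, Module.finrank_baseChange]

theorem finrank_kaehlerDifferential_baseChange {B C : Type*} (F L : Type*) [CommRing B]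
    [CommRing C] [Algebra B C] [CommRing F] [Algebra B F] [Field L] [Algebra (F ⊗[B] C) L]
    [Algebra C L] (h : (algebraMap (F ⊗[B] C) L).comp
      (Algebra.TensorProduct.includeRight : C →ₐ[B] F ⊗[B] C).toRingHom = algebraMap C L) :
    Module.finrank L (L ⊗[F ⊗[B] C] (KaehlerDifferential F (F ⊗[B] C))) =
      Module.finrank L (L ⊗[C] (KaehlerDifferential B C)) := by
  let : Algebra C (F ⊗[B] C) := Algebra.TensorProduct.rightAlgebra
  have : IsScalarTower C (F ⊗[B] C) L := .of_algebraMap_eq' h.symm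
  let e := KaehlerDifferential.tensorKaehlerEquiv B F C (F ⊗[B] C)
  rw [← (AlgebraTensorModule.congr (LinearEquiv.refl L L) e).finrank_eq,
    (AlgebraTensorModule.cancelBaseChange C (F ⊗[B] C) L L _).finrank_eq]

theorem mem_kaehlerRankLocus_tensorProduct_iff {B C F : Type*} [CommRing B] [CommRing C]
    [Algebra B C] [CommRing F] [Algebra B F] {d : ℕ} {y : PrimeSpectrum (F ⊗[B] C)} :
    y ∈ kaehlerRankLocus F (F ⊗[B] C) d ↔
      y.comap (Algebra.TensorProduct.includeRight : C →ₐ[B] F ⊗[B] C).toRingHom ∈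
        kaehlerRankLocus B C d := by
  let f := (Algebra.TensorProduct.includeRight : C →ₐ[B] F ⊗[B] C).toRingHom
  let x := y.comap f
  let := ((algebraMap (F ⊗[B] C) y.asIdeal.ResidueField).comp f).toAlgebra
  let := (Ideal.ResidueField.map x.asIdeal y.asIdeal f rfl).toAlgebra
  have : IsScalarTower C x.asIdeal.ResidueField y.asIdeal.ResidueField :=
    .of_algebraMap_eq fun c => (Ideal.ResidueField.map_algebraMap x.asIdeal y.asIdeal f rfl c).symm
  change d + 1 ≤ Module.finrank y.asIdeal.ResidueField (y.asIdeal.ResidueField ⊗[F ⊗[B] C] _) ↔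
    d + 1 ≤ Module.finrank x.asIdeal.ResidueField (x.asIdeal.ResidueField ⊗[C] _)
  rw [finrank_kaehlerDifferential_baseChange F y.asIdeal.ResidueField rfl,
    TensorProduct.finrank_tensorProduct_eq x.asIdeal.ResidueField y.asIdeal.ResidueField]

theorem isClosed_kaehlerRankLocus {B C : Type*} [CommRing B] [CommRing C] [Algebra B C]
    [Algebra.FiniteType B C] (d : ℕ) : IsClosed (kaehlerRankLocus B C d) :=
  PrimeSpectrum.isClosed_setOf_le_finrank_residueField_tensorProduct _ d

theorem componentsCodimGE_iff {C : Type*} [CommRing C] [IsNoetherianRing C]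
    {Z : Set (PrimeSpectrum C)} {m : ℕ∞} :
    componentsCodimGE Z m ↔ ∀ x ∈ Z, m ≤ Order.height x := by
  refine ⟨fun h x hx => ?_, fun h x hx => h x hx.prop⟩
  have : WellFoundedLT (PrimeSpectrum C) := StrictMono.wellFoundedLT
    (f := fun p : PrimeSpectrum C => p.asIdeal.height)
    fun _ _ h => Ideal.height_strict_mono_of_isPrime h
  obtain ⟨y, hyx, hy⟩ := exists_minimal_le_of_wellFoundedLT (· ∈ Z) x hx
  exact (h y hy).trans (Order.height_mono hyx)

theorem componentsCodimGE_kaehlerRankLocus_fiber_iff {B C : Type*} [CommRing B] [CommRing C]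
    [Algebra B C] [Algebra.FiniteType B C] {d c : ℕ} {s : PrimeSpectrum B} :
    componentsCodimGE (kaehlerRankLocus s.asIdeal.ResidueField
      (s.asIdeal.ResidueField ⊗[B] C) d) (c + 1) ↔
      ∀ x ∈ kaehlerRankLocus B C d, x.comap (algebraMap B C) = s →
        (c + 1 : ℕ) ≤ PrimeSpectrum.fiberHeight B x := by
  have : IsNoetherianRing (s.asIdeal.ResidueField ⊗[B] C) :=
    Algebra.FiniteType.isNoetherianRing s.asIdeal.ResidueField _
  let e := PrimeSpectrum.preimageOrderIsoFiber B C s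
  have key (x) : e x ∈ kaehlerRankLocus s.asIdeal.ResidueField
      (s.asIdeal.ResidueField ⊗[B] C) d ↔ x.1 ∈ kaehlerRankLocus B C d := by
    obtain ⟨y, rfl⟩ := e.symm.surjective x
    rw [e.apply_symm_apply]
    exact mem_kaehlerRankLocus_tensorProduct_iff
  rw [componentsCodimGE_iff]
  constructor
  · intro h x hx hxs
    rw [← PrimeSpectrum.height_preimageOrderIsoFiber ⟨x, hxs⟩]
    exact_mod_cast h (e ⟨x, hxs⟩) ((key ⟨x, hxs⟩).2 hx)
  · intro h y hy
    obtain ⟨x, rfl⟩ := e.surjective y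
    rw [PrimeSpectrum.height_preimageOrderIsoFiber x]
    exact_mod_cast h x.1 ((key x).1 hy) x.2

theorem statement_7 {k : Type*} [Field k] {B : Type*} [CommRing B] [Algebra k B]
    [Algebra.FiniteType k B] {C : Type*} [CommRing C]
    [Algebra (firstOrderBase B) C] [Module.Flat (firstOrderBase B) C]
    [Algebra.FiniteType (firstOrderBase B) C]
    [Algebra B C] [IsScalarTower B (firstOrderBase B) C]
    (d c : ℕ) :
    IsConstructibleSet {s : PrimeSpectrum B |
      componentsCodimGE
        (kaehlerRankLocus (ResidueField (Localization.AtPrime s.asIdeal))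
          ((ResidueField (Localization.AtPrime s.asIdeal)) ⊗[B] C) d) (c + 1)} := by
  have : IsNoetherianRing B := Algebra.FiniteType.isNoetherianRing k B
  have : Algebra.FiniteType B C := .trans (S := firstOrderBase B) inferInstance inferInstance
  simp_rw [componentsCodimGE_kaehlerRankLocus_fiber_iff]
  exact PrimeSpectrum.isConstructibleSet_of_isConstructible
    (PrimeSpectrum.isConstructible_setOf_add_one_le_fiberHeight (isClosed_kaehlerRankLocus d) c)
end

section
/- Let k'/k be a finite extension of fields of characteristic 0, let C be a finite type k-algebra, and fix nonnegative integers d and c. Set C' = C ⊗_k k'. Let Z = { x ∈ Spec C : dim_{κ(x)} (κ(x) ⊗_C Ω_{C/k}) ≥ d + 1 } and Z' = { x ∈ Spec C' : dim_{κ(x)} (κ(x) ⊗_{C'} Ω_{C'/k'}) ≥ d + 1 }, where κ(x) denotes the residue field of the point x. Then every irreducible component of Z has codimension at least c + 1 in Spec C if and only if every irreducible component of Z' has codimension at least c + 1 in Spec C'. -/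
/-!
STATEMENT 8.
Let `k'/k` be a finite extension of fields of characteristic `0`, `C` a finite type
`k`-algebra and `C' = C ⊗_k k'` (written `k' ⊗[k] C` in Mathlib's convention).  For the
loci `Z ⊆ Spec C` and `Z' ⊆ Spec C'` where the fiber rank of the Kähler differentials is
`≥ d + 1`, every irreducible component of `Z` has codimension `≥ c + 1` iff every
irreducible component of `Z'` has codimension `≥ c + 1`.
-/

open TensorProduct IsLocalRing

section IntegralFlat

variable {A B : Type*} [CommRing A] [CommRing B] [Algebra A B]

theorem PrimeSpectrum.strictMono_comap_of_isIntegral [Algebra.IsIntegral A B] :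
    StrictMono (PrimeSpectrum.comap (algebraMap A B)) :=
  fun _ _ h ↦ Ideal.IsIntegral.comap_lt_comap h

theorem PrimeSpectrum.exists_le_comap_eq_of_hasGoingDown [Algebra.HasGoingDown A B]
    {p : PrimeSpectrum A} {q : PrimeSpectrum B}
    (h : p ≤ PrimeSpectrum.comap (algebraMap A B) q) :
    ∃ q' ≤ q, PrimeSpectrum.comap (algebraMap A B) q' = p := by
  obtain ⟨Q, hQ, _, hQp⟩ :=
    q.asIdeal.exists_ideal_le_liesOver_of_le (p := p.asIdeal) (q := q.asIdeal.under A) h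
  exact ⟨⟨Q, inferInstance⟩, hQ, PrimeSpectrum.ext hQp.over.symm⟩

theorem PrimeSpectrum.height_comap_of_isIntegral_of_hasGoingDown [Algebra.IsIntegral A B]
    [Algebra.HasGoingDown A B] (q : PrimeSpectrum B) :
    Order.height (PrimeSpectrum.comap (algebraMap A B) q) = Order.height q := by
  refine le_antisymm ?_
    (Order.height_le_height_apply_of_strictMono _ strictMono_comap_of_isIntegral q)
  refine Order.height_le fun l hl ↦ ?_
  have : q.asIdeal.LiesOver l.last.asIdeal := ⟨by rw [hl]; rfl⟩
  obtain ⟨L, hlen, hlast, -⟩ := Ideal.exists_ltSeries_of_hasGoingDown l q.asIdeal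
  rw [← hlen]
  exact Order.length_le_height hlast.le

/-- Along an integral algebra with going down and surjective map on spectra, the condition on
codimensions of components is compatible with taking preimages. -/
theorem componentsCodimGE_preimage_comap_iff [Algebra.IsIntegral A B] [Algebra.HasGoingDown A B]
    (hsurj : Function.Surjective (PrimeSpectrum.comap (algebraMap A B)))
    (Z : Set (PrimeSpectrum A)) (m : ℕ∞) :
    componentsCodimGE (PrimeSpectrum.comap (algebraMap A B) ⁻¹' Z) m ↔
      componentsCodimGE Z m := by
  have hmono := PrimeSpectrum.strictMono_comap_of_isIntegral (A := A) (B := B)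
  constructor
  · intro H x hx
    obtain ⟨y, rfl⟩ := hsurj x
    rw [PrimeSpectrum.height_comap_of_isIntegral_of_hasGoingDown]
    refine H y ⟨hx.prop, fun y' hy' hle ↦ ?_⟩
    by_contra hnot
    exact hx.not_prop_of_lt (hmono (lt_of_le_not_ge hle hnot)) hy'
  · intro H y hy
    rw [← PrimeSpectrum.height_comap_of_isIntegral_of_hasGoingDown (A := A)]
    refine H _ ⟨hy.prop, fun x hx hle ↦ ?_⟩
    obtain ⟨y', hle', rfl⟩ := PrimeSpectrum.exists_le_comap_eq_of_hasGoingDown hle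
    exact hmono.monotone (hy.le_of_le hx hle')

theorem finrank_residueField_tensorProduct_baseChange (M : Type*) [AddCommGroup M] [Module A M]
    (p : Ideal A) [p.IsPrime] (q : Ideal B) [q.IsPrime] (h : p = q.comap (algebraMap A B)) :
    Module.finrank q.ResidueField (q.ResidueField ⊗[B] (B ⊗[A] M)) =
      Module.finrank p.ResidueField (p.ResidueField ⊗[A] M) := by
  let : Algebra p.ResidueField q.ResidueField :=
    (Ideal.ResidueField.map p q (algebraMap A B) h).toAlgebra
  have : IsScalarTower A p.ResidueField q.ResidueField := .of_algebraMap_eq fun a ↦ by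
    rw [RingHom.algebraMap_toAlgebra, Ideal.ResidueField.map_algebraMap,
      ← IsScalarTower.algebraMap_apply]
  rw [(TensorProduct.AlgebraTensorModule.cancelBaseChange A B q.ResidueField
      q.ResidueField M).finrank_eq,
    ← (TensorProduct.AlgebraTensorModule.cancelBaseChange A p.ResidueField q.ResidueField
      q.ResidueField M).finrank_eq, Module.finrank_baseChange]

theorem kaehlerRankLocus_eq_preimage_comap (F F' : Type*) [CommRing F] [CommRing F']
    [Algebra F F'] [Algebra F A] [Algebra F B] [Algebra F' B] [IsScalarTower F A B]
    [IsScalarTower F F' B] [Algebra.IsPushout F F' A B] (d : ℕ) :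
    kaehlerRankLocus F' B d =
      PrimeSpectrum.comap (algebraMap A B) ⁻¹' kaehlerRankLocus F A d := by
  ext y
  simp only [kaehlerRankLocus, Set.mem_preimage, Set.mem_ofPred_eq]
  rw [← (TensorProduct.AlgebraTensorModule.congr (.refl y.asIdeal.ResidueField
      y.asIdeal.ResidueField) (KaehlerDifferential.tensorKaehlerEquiv F F' A B)).finrank_eq,
    finrank_residueField_tensorProduct_baseChange _
      (PrimeSpectrum.comap (algebraMap A B) y).asIdeal y.asIdeal rfl]

end IntegralFlat

theorem statement_8 {k k' : Type*} [Field k] [CharZero k] [Field k'] [Algebra k k']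
    [Module.Finite k k'] {C : Type*} [CommRing C] [Algebra k C] [Algebra.FiniteType k C]
    (d c : ℕ) :
    componentsCodimGE (kaehlerRankLocus k C d) (c + 1) ↔
      componentsCodimGE (kaehlerRankLocus k' (k' ⊗[k] C) d) (c + 1) := by
  let : Algebra C (k' ⊗[k] C) := Algebra.TensorProduct.rightAlgebra
  have : Module.Finite C (k' ⊗[k] C) :=
    .equiv (Algebra.IsPushout.equiv k C k' (k' ⊗[k] C)).toLinearEquiv
  have : Module.FaithfullyFlat C (k' ⊗[k] C) :=
    .of_linearEquiv _ _ (Algebra.IsPushout.equiv k C k' (k' ⊗[k] C)).toLinearEquiv.symm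
  rw [kaehlerRankLocus_eq_preimage_comap (A := C) k k' d,
    componentsCodimGE_preimage_comap_iff PrimeSpectrum.comap_surjective_of_faithfullyFlat]
end

section
/- Let k be a field and let A be an integral domain of finite type over the formal power series ring k[[t]], in which the image of t is nonzero and generates a proper ideal tA ≠ A. Set n = dim A (Krull dimension). Then: (1) every minimal prime p of the ideal tA has height exactly 1 and satisfies dim (A/p) = n − 1; (2) every maximal ideal m of A containing t has height n (that is, dim A_m = n), and the residue field A/m is a finite extension of k. -/
/-!
STATEMENT 9.
Let `k` be a field and `A` an integral domain of finite type over `k[[t]]` in which the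
image `t'` of `t` is nonzero and generates a proper ideal.  With `n = dim A`:
(1) every minimal prime `p` of `t'A` has height exactly `1` and `dim (A ⧸ p) = n - 1`
    (stated as `dim (A ⧸ p) + 1 = n`);
(2) every maximal ideal `m` containing `t'` has height `n` and residue field `A ⧸ m`
    finite over `k`.

The height of a prime `p` is the Krull dimension of the localization `A_p`.
-/

/-- The height of a prime ideal `p`: the Krull dimension of the localization `A_p`. -/
noncomputable def primeHeight {A : Type*} [CommRing A] (p : Ideal A) (hp : p.IsPrime) :
    WithBot (WithTop ℕ) :=
  haveI := hp
  ringKrullDim (Localization.AtPrime p)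

open MvPolynomial in
/-- A weak form of Noether normalization. -/
theorem exists_algebraicIndependent_ringKrullDim_le (K B : Type*) [Field K] [CommRing B]
    [Nontrivial B] [Algebra K B] [Algebra.FiniteType K B] :
    ∃ (s : ℕ) (x : Fin s → B), AlgebraicIndependent K x ∧ ringKrullDim B ≤ s := by
  obtain ⟨s, g, hg, hint⟩ := exists_integral_inj_algHom_of_fg K B
  refine ⟨s, fun i ↦ g (X i), ?_, ?_⟩
  · rw [AlgebraicIndependent, show aeval (fun i ↦ g (X i)) = g by ext; simp]
    exact hg
  · algebraize [g.toRingHom]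
    calc ringKrullDim B ≤ ringKrullDim (MvPolynomial (Fin s) K) :=
          Order.krullDim_le_of_strictMono (PrimeSpectrum.comap (algebraMap _ B))
            fun p q h ↦ Ideal.IsIntegral.comap_lt_comap (I := p.asIdeal) (J := q.asIdeal) h
      _ = s := by simp [MvPolynomial.ringKrullDim_of_isNoetherianRing]

open TensorProduct in
/-- In a finite type extension of domains, a prime lying over zero has height at most the
transcendence degree. -/
theorem Ideal.height_le_trdeg_of_under_eq_bot {R A : Type*} [CommRing R] [IsDomain R]
    [CommRing A] [IsDomain A] [Algebra R A] [Algebra.FiniteType R A] [FaithfulSMul R A]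
    (p : Ideal A) [p.IsPrime] (hp : p.under R = ⊥) (d : ℕ) (hd : Algebra.trdeg R A = d) :
    p.height ≤ d := by
  let K := FractionRing R
  let B := A ⊗[R] K
  let : Algebra K B := Algebra.TensorProduct.rightAlgebra
  have : IsScalarTower R K B := Algebra.TensorProduct.right_isScalarTower
  let S := Algebra.algebraMapSubmonoid A (nonZeroDivisors R)
  have hS : S ≤ nonZeroDivisors A := by
    rintro _ ⟨r, hr, rfl⟩
    exact mem_nonZeroDivisors_of_ne_zero (by simpa using nonZeroDivisors.ne_zero hr)
  have : IsLocalization S B := inferInstance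
  have : IsDomain B := IsLocalization.isDomain_of_le_nonZeroDivisors (S := B) hS
  have hinj : Function.Injective (algebraMap A B) := IsLocalization.injective B hS
  have : Algebra.FiniteType K B :=
    .of_surjective (Algebra.TensorProduct.commRight R K A).toAlgHom
      (Algebra.TensorProduct.commRight R K A).surjective
  have : FaithfulSMul A B := (faithfulSMul_iff_algebraMap_injective A B).mpr hinj
  obtain ⟨s, x, hx, hdim⟩ := exists_algebraicIndependent_ringKrullDim_le K B
  have hx' : AlgebraicIndependent R x := hx.restrictScalars (IsFractionRing.injective R K)
  have : Algebra.IsAlgebraic A B := IsLocalization.isAlgebraic B S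
  have hs : s ≤ d := by
    have h1 := hx'.lift_cardinalMk_le_trdeg
    have h2 := _root_.lift_trdeg_add_eq R A B
    simp only [hd, trdeg_eq_zero, Cardinal.lift_natCast, Cardinal.lift_zero,
      add_zero, Cardinal.mk_fin, Cardinal.lift_uzero] at h1 h2
    rw [eq_comm, Cardinal.lift_eq_nat_iff] at h2
    exact_mod_cast h1.trans_eq h2
  have hdisj : Disjoint (S : Set A) (p : Set A) := by
    rw [Set.disjoint_left]
    rintro _ ⟨r, hr, rfl⟩ hrp
    exact nonZeroDivisors.ne_zero hr (by simpa [hp] using (show r ∈ p.under R from hrp))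
  have := IsLocalization.isPrime_of_isPrime_disjoint S B p ‹_› hdisj
  rw [← IsLocalization.height_map_of_disjoint S (S := B) p hdisj]
  have := (Ideal.height_le_ringKrullDim_of_isPrime (I := p.map (algebraMap A B))).trans hdim
  exact (WithBot.coe_le_coe.mp this).trans (by exact_mod_cast hs)

theorem algebraMap_constantCoeff_quotient {k A : Type*} [Field k] [CommRing A]
    [Algebra (PowerSeries k) A] [Algebra k A] [IsScalarTower k (PowerSeries k) A] (I : Ideal A)
    (hI : algebraMap (PowerSeries k) A PowerSeries.X ∈ I) (r : PowerSeries k) :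
    algebraMap k (A ⧸ I) (PowerSeries.constantCoeff r) =
      Ideal.Quotient.mk I (algebraMap (PowerSeries k) A r) := by
  obtain ⟨c, hc⟩ : PowerSeries.X ∣ r - PowerSeries.C (PowerSeries.constantCoeff r) := by
    simp [PowerSeries.X_dvd_iff]
  rw [IsScalarTower.algebraMap_apply k A (A ⧸ I), Ideal.Quotient.algebraMap_eq,
    IsScalarTower.algebraMap_apply k (PowerSeries k) A, eq_comm, Ideal.Quotient.eq, ← map_sub]
  change algebraMap _ _ (r - PowerSeries.C (PowerSeries.constantCoeff r)) ∈ I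
  rw [hc, map_mul]
  exact I.mul_mem_right _ hI

theorem Algebra.FiniteType.quotient_of_powerSeriesX_mem {k A : Type*} [Field k] [CommRing A]
    [Algebra (PowerSeries k) A] [Algebra.FiniteType (PowerSeries k) A]
    [Algebra k A] [IsScalarTower k (PowerSeries k) A] (I : Ideal A)
    (hI : algebraMap (PowerSeries k) A PowerSeries.X ∈ I) : Algebra.FiniteType k (A ⧸ I) := by
  obtain ⟨s, hs⟩ := (inferInstance : Algebra.FiniteType (PowerSeries k) (A ⧸ I)).out
  refine ⟨s, Algebra.eq_top_iff.mpr fun a ↦ ?_⟩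
  have ha : a ∈ Algebra.adjoin (PowerSeries k) (s : Set (A ⧸ I)) := hs ▸ Algebra.mem_top
  induction ha using Algebra.adjoin_induction with
  | mem x hx => exact Algebra.subset_adjoin hx
  | algebraMap r =>
    rw [IsScalarTower.algebraMap_apply (PowerSeries k) A (A ⧸ I), Ideal.Quotient.algebraMap_eq,
      ← algebraMap_constantCoeff_quotient I hI]
    exact Subalgebra.algebraMap_mem (Algebra.adjoin k (s : Set (A ⧸ I))) _
  | add x y _ _ hx hy => exact add_mem hx hy
  | mul x y _ _ hx hy => exact mul_mem hx hy

/-- Elements which are algebraically independent over `k` modulo an ideal containing `X` are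
algebraically independent over `k⟦X⟧`. -/
theorem AlgebraicIndependent.of_quotient_of_powerSeriesX_mem {k A ι : Type*} [Field k] [CommRing A]
    [IsDomain A] [Algebra (PowerSeries k) A] [Algebra k A] [IsScalarTower k (PowerSeries k) A]
    (hX : algebraMap (PowerSeries k) A PowerSeries.X ≠ 0) (I : Ideal A)
    (hI : algebraMap (PowerSeries k) A PowerSeries.X ∈ I) (x : ι → A)
    (hx : AlgebraicIndependent k fun i ↦ Ideal.Quotient.mk I (x i)) :
    AlgebraicIndependent (PowerSeries k) x := by
  rw [algebraicIndependent_iff]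
  intro P hP
  by_contra hP0
  have hprime : Prime (MvPolynomial.C PowerSeries.X : MvPolynomial ι (PowerSeries k)) :=
    (MvPolynomial.prime_C_iff _).mpr PowerSeries.X_prime
  obtain ⟨Q, hQ, hdvd⟩ :=
    (FiniteMultiplicity.of_prime_left hprime hP0).exists_eq_pow_mul_and_not_dvd
  rw [hQ, map_mul, map_pow, MvPolynomial.aeval_C] at hP
  replace hP := (mul_eq_zero.mp hP).resolve_left (pow_ne_zero _ hX)
  refine hdvd ((MvPolynomial.C_dvd_iff_dvd_coeff _ _).mpr fun i ↦ PowerSeries.X_dvd_iff.mpr ?_)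
  have hmap : ∀ r, algebraMap k (A ⧸ I) (PowerSeries.constantCoeff r) =
      Ideal.Quotient.mk I (algebraMap (PowerSeries k) A r) :=
    algebraMap_constantCoeff_quotient I hI
  have hQ0 : MvPolynomial.map PowerSeries.constantCoeff Q = 0 := by
    refine (algebraicIndependent_iff.mp hx) _ ?_
    rw [MvPolynomial.aeval_def, MvPolynomial.eval₂_map, ← map_zero (Ideal.Quotient.mk I), ← hP,
      MvPolynomial.aeval_def, MvPolynomial.hom_eval₂]
    congr 1
    ext r
    exact hmap r
  rw [← MvPolynomial.coeff_map, hQ0, MvPolynomial.coeff_zero]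

/-- If a maximal ideal `m` is minimal over the ideal generated by `X` and a set `s`, then `m` is
isolated in its fibre over `C := k⟦X⟧[s]`, so `A` is algebraic over `C` by Zariski's main
theorem. -/
theorem trdeg_le_card_of_mem_minimalPrimes {k A : Type*} [Field k] [CommRing A]
    [IsDomain A] [Algebra (PowerSeries k) A] [Algebra.FiniteType (PowerSeries k) A]
    [Algebra k A] [IsScalarTower k (PowerSeries k) A] (m : Ideal A) [m.IsMaximal] (s : Set A)
    (hm : m ∈ (Ideal.span
      (insert (algebraMap (PowerSeries k) A PowerSeries.X) s)).minimalPrimes) :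
    Algebra.trdeg (PowerSeries k) A ≤ Cardinal.mk s := by
  let C := Algebra.adjoin (PowerSeries k) s
  have : Algebra.FiniteType C A := .of_restrictScalars_finiteType (PowerSeries k) C A
  let I : Ideal A := (m.under C).map (algebraMap C A)
  have hIm : I ≤ m := Ideal.map_comap_le
  have hX : algebraMap (PowerSeries k) A PowerSeries.X ∈ m := hm.1.2 (Ideal.subset_span (by simp))
  have hXI : algebraMap (PowerSeries k) A PowerSeries.X ∈ I :=
    Ideal.mem_map_of_mem (algebraMap C A) (x := algebraMap (PowerSeries k) C PowerSeries.X) hX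
  have hsI : s ⊆ I := fun a ha ↦ Ideal.mem_map_of_mem (algebraMap C A)
    (x := ⟨a, Algebra.subset_adjoin ha⟩) (hm.1.2 (Ideal.subset_span (by simp [ha])))
  have : Algebra.FiniteType k (A ⧸ I) := .quotient_of_powerSeriesX_mem I hXI
  have hker : RingHom.ker (Ideal.Quotient.mk I) ≤ m := by rwa [Ideal.mk_ker]
  have hcomap : (m.map (Ideal.Quotient.mk I)).comap (Ideal.Quotient.mk I) = m := by
    rw [Ideal.comap_map_of_surjective' _ Ideal.Quotient.mk_surjective]; simpa using hIm
  have hmax : (m.map (Ideal.Quotient.mk I)).IsMaximal :=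
    Ideal.IsMaximal.map_of_surjective_of_ker_le Ideal.Quotient.mk_surjective hker
  have hopen : IsOpen ({⟨m.map (Ideal.Quotient.mk I), hmax.isPrime⟩} :
      Set (PrimeSpectrum (A ⧸ I))) := by
    have : IsJacobsonRing (A ⧸ I) := isJacobsonRing_of_finiteType (A := k)
    have : IsNoetherianRing (A ⧸ I) := Algebra.FiniteType.isNoetherianRing k _
    have htfae := (PrimeSpectrum.isOpen_singleton_tfae_of_isNoetherian_of_isJacobsonRing
      (⟨m.map (Ideal.Quotient.mk I), hmax.isPrime⟩ : PrimeSpectrum (A ⧸ I))).out 0 2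
    refine htfae.mpr ⟨(PrimeSpectrum.isClosed_singleton_iff_isMaximal _).mpr hmax, ?_⟩
    rintro _ y hy rfl
    rw [← PrimeSpectrum.le_iff_specializes] at hy
    have hle : y.asIdeal.comap (Ideal.Quotient.mk I) ≤ m :=
      (Ideal.comap_mono hy).trans hcomap.le
    have hIy : I ≤ y.asIdeal.comap (Ideal.Quotient.mk I) := by
      rw [← Ideal.map_le_iff_le_comap]
      simp
    have hspan : Ideal.span (insert (algebraMap (PowerSeries k) A PowerSeries.X) s) ≤
        y.asIdeal.comap (Ideal.Quotient.mk I) :=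
      Ideal.span_le.mpr ((Set.insert_subset hXI hsI).trans hIy)
    exact PrimeSpectrum.ext (le_antisymm hy
      (Ideal.map_le_iff_le_comap.mpr (hm.2 ⟨inferInstance, hspan⟩ hle)))
  have hqf : Algebra.QuasiFiniteAt k (m.map (Ideal.Quotient.mk I)) :=
    Algebra.QuasiFiniteAt.of_isOpen_singleton ⟨m.map (Ideal.Quotient.mk I), hmax.isPrime⟩ hopen
  have : Algebra.WeaklyQuasiFiniteAt C m :=
    have h := Algebra.QuasiFinite.of_restrictScalars k C
      (Localization.AtPrime (m.map (Ideal.Quotient.mk I)))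
    by
      delta Algebra.WeaklyQuasiFiniteAt Algebra.QuasiFiniteAt
      convert h
      exact Algebra.algebra_ext _ _ fun r ↦ rfl
  obtain ⟨r, hrm, hr⟩ := Algebra.zariskisMainProperty_iff'.mp
    (Algebra.ZariskisMainProperty.of_finiteType_of_weaklyQuasiFiniteAt (R := C) m)
  have hr0 : r ≠ 0 := fun h ↦ hrm (h ▸ m.zero_mem)
  have : Algebra.IsAlgebraic C A := by
    have hralg : IsAlgebraic C r := by
      obtain ⟨n, hn⟩ := hr r
      rw [← pow_succ] at hn
      exact (hn.of_pow n.succ_pos).isAlgebraic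
    refine ⟨fun x ↦ ?_⟩
    obtain ⟨n, hn⟩ := hr x
    exact .of_mul (mem_nonZeroDivisors_of_ne_zero (pow_ne_zero n hr0)) (hralg.pow n)
      hn.isAlgebraic
  exact Algebra.IsAlgebraic.trdeg_le_cardinalMk (PowerSeries k) s

theorem Ideal.under_eq_bot_of_powerSeriesX_notMem {k A : Type*} [Field k] [CommRing A]
    [Algebra (PowerSeries k) A] (p : Ideal A) [p.IsPrime]
    (hp : algebraMap (PowerSeries k) A PowerSeries.X ∉ p) : p.under (PowerSeries k) = ⊥ := by
  refine (Submodule.eq_bot_iff _).mpr fun r hr ↦ ?_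
  by_contra hr0
  obtain ⟨n, u, rfl⟩ := IsDiscreteValuationRing.eq_unit_mul_pow_irreducible hr0
    PowerSeries.X_irreducible
  rw [Ideal.unit_mul_mem_iff_mem _ u.isUnit] at hr
  rw [Ideal.mem_comap, map_pow] at hr
  exact hp (Ideal.IsPrime.mem_of_pow_mem inferInstance n hr)

theorem Ideal.height_add_one_le_height_comap_quotientMk {A : Type*} [CommRing A] [IsDomain A]
    [IsNoetherianRing A] {I : Ideal A} (hI : I ≠ ⊥) (p : Ideal (A ⧸ I)) [p.IsPrime] :
    p.height + 1 ≤ (p.comap (Ideal.Quotient.mk I)).height := by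
  obtain ⟨l, hlast, hlen⟩ := p.exists_ltSeries_length_eq_height
  have hmono : StrictMono (PrimeSpectrum.comap (Ideal.Quotient.mk I)) :=
    Monotone.strictMono_of_injective (fun _ _ h ↦ Ideal.comap_mono h)
      (PrimeSpectrum.comap_injective_of_surjective _ Ideal.Quotient.mk_surjective)
  let l' := l.map _ hmono
  have hbot : (⊥ : PrimeSpectrum A) < l'.head := by
    refine bot_lt_iff_ne_bot.mpr fun h ↦ hI (le_bot_iff.mp ?_)
    rw [← show l'.head.asIdeal = ⊥ by rw [h]; rfl]
    intro a ha
    simp [l', Ideal.Quotient.eq_zero_iff_mem.mpr ha]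
  have h := Order.length_le_height_last (p := l'.cons ⊥ hbot)
  rw [RelSeries.last_cons, LTSeries.last_map, hlast, ← PrimeSpectrum.height_eq_orderHeight,
    RelSeries.cons_length] at h
  rw [← hlen]
  exact_mod_cast h

section

variable {k A : Type*} [Field k] [CommRing A] [IsDomain A] [Algebra (PowerSeries k) A]
  [Algebra.FiniteType (PowerSeries k) A] [Algebra k A] [IsScalarTower k (PowerSeries k) A]

theorem ringKrullDim_quotient_le_of_powerSeriesX_mem
    (hX : algebraMap (PowerSeries k) A PowerSeries.X ≠ 0) {I : Ideal A}
    (hI : algebraMap (PowerSeries k) A PowerSeries.X ∈ I) (d : ℕ)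
    (hd : Algebra.trdeg (PowerSeries k) A = d) : ringKrullDim (A ⧸ I) ≤ d := by
  nontriviality A ⧸ I
  have : Algebra.FiniteType k (A ⧸ I) := .quotient_of_powerSeriesX_mem I hI
  obtain ⟨s, x, hx, hdim⟩ := exists_algebraicIndependent_ringKrullDim_le k (A ⧸ I)
  obtain ⟨y, rfl⟩ := Ideal.Quotient.mk_surjective.comp_left x
  have h := (AlgebraicIndependent.of_quotient_of_powerSeriesX_mem hX I hI y
    hx).lift_cardinalMk_le_trdeg
  have hs : s ≤ d := by simpa [hd] using h
  exact hdim.trans (by exact_mod_cast hs)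

theorem Ideal.le_height_map_quotientMk_of_isMaximal {I m : Ideal A} [m.IsMaximal] (hIm : I ≤ m)
    (hI : algebraMap (PowerSeries k) A PowerSeries.X ∈ I)
    (hmin : ∀ q : Ideal A, q.IsPrime → q ≤ m → algebraMap (PowerSeries k) A PowerSeries.X ∈ q →
      I ≤ q) (d : ℕ) (hd : Algebra.trdeg (PowerSeries k) A = d) :
    d ≤ (m.map (Ideal.Quotient.mk I)).height := by
  classical
  have : IsNoetherianRing A := Algebra.FiniteType.isNoetherianRing (PowerSeries k) A
  have hcomap : ∀ q : Ideal A, I ≤ q →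
      (q.map (Ideal.Quotient.mk I)).comap (Ideal.Quotient.mk I) = q := fun q hq ↦ by
    rw [Ideal.comap_map_of_surjective' _ Ideal.Quotient.mk_surjective]; simpa using hq
  have hprime : ∀ q : Ideal A, q.IsPrime → I ≤ q → (q.map (Ideal.Quotient.mk I)).IsPrime :=
    fun q _ hq ↦ Ideal.map_isPrime_of_surjective Ideal.Quotient.mk_surjective (by simpa using hq)
  have := hprime m inferInstance hIm
  obtain ⟨s, hs, hcard⟩ :=
    (m.map (Ideal.Quotient.mk I)).exists_finset_card_eq_height_of_isNoetherianRing
  let f := Function.surjInv (Ideal.Quotient.mk_surjective (I := I))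
  have hf : ∀ b, Ideal.Quotient.mk I (f b) = b := Function.surjInv_eq _
  have hm : m ∈ (Ideal.span (insert (algebraMap (PowerSeries k) A PowerSeries.X)
      (s.image f : Set A))).minimalPrimes := by
    refine ⟨⟨inferInstance, ?_⟩, fun q ⟨_, hq⟩ hqm ↦ ?_⟩
    · rw [Ideal.span_le, Set.insert_subset_iff]
      refine ⟨hIm hI, ?_⟩
      simp only [Finset.coe_image, Set.image_subset_iff]
      intro b hb
      change f b ∈ m
      rw [← hcomap m hIm, Ideal.mem_comap, hf]
      exact hs.1.2 (Ideal.subset_span hb)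
    · rw [Ideal.span_le, Set.insert_subset_iff] at hq
      have hIq := hmin q ‹_› hqm hq.1
      have hle : Ideal.span (s : Set (A ⧸ I)) ≤ q.map (Ideal.Quotient.mk I) := by
        refine Ideal.span_le.mpr fun b hb ↦ ?_
        rw [← hf b]
        exact Ideal.mem_map_of_mem _ (hq.2 (Finset.mem_coe.mpr (Finset.mem_image_of_mem f hb)))
      rw [← hcomap m hIm, ← hcomap q hIq]
      exact Ideal.comap_mono (hs.2 ⟨hprime q ‹_› hIq, hle⟩ (Ideal.map_mono hqm))
  have h := trdeg_le_card_of_mem_minimalPrimes (k := k) m _ hm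
  have hds : d ≤ (s.image f).card := by simpa [hd] using h
  rw [← hcard]
  exact_mod_cast hds.trans Finset.card_image_le

theorem Ideal.height_eq_trdeg_add_one_of_isMaximal
    (hX : algebraMap (PowerSeries k) A PowerSeries.X ≠ 0) {m : Ideal A} [m.IsMaximal]
    (hm : algebraMap (PowerSeries k) A PowerSeries.X ∈ m) (d : ℕ)
    (hd : Algebra.trdeg (PowerSeries k) A = d) : m.height = d + 1 := by
  have : IsNoetherianRing A := Algebra.FiniteType.isNoetherianRing (PowerSeries k) A
  have hXI := Ideal.mem_span_singleton_self (algebraMap (PowerSeries k) A PowerSeries.X)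
  have hIm := (Ideal.span_singleton_le_iff_mem m).mpr hm
  apply le_antisymm
  · have h := (Ideal.height_le_ringKrullDim_quotient_add_one hm).trans
      (add_le_add_left (ringKrullDim_quotient_le_of_powerSeriesX_mem hX hXI d hd) 1)
    exact_mod_cast h
  · let I := Ideal.span {algebraMap (PowerSeries k) A PowerSeries.X}
    have hcomap : (m.map (Ideal.Quotient.mk I)).comap (Ideal.Quotient.mk I) = m := by
      rw [Ideal.comap_map_of_surjective' _ Ideal.Quotient.mk_surjective]; simpa [I] using hIm
    have : (m.map (Ideal.Quotient.mk I)).IsPrime :=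
      Ideal.map_isPrime_of_surjective Ideal.Quotient.mk_surjective (by simpa [I] using hIm)
    have h := Ideal.height_add_one_le_height_comap_quotientMk
      (by simpa [I] using hX) (m.map (Ideal.Quotient.mk I))
    rw [hcomap] at h
    refine le_trans (add_le_add_left ?_ 1) h
    exact Ideal.le_height_map_quotientMk_of_isMaximal hIm hXI
      (fun q _ _ hq ↦ (Ideal.span_singleton_le_iff_mem q).mpr hq) d hd

theorem ringKrullDim_eq_trdeg_add_one
    (hX : algebraMap (PowerSeries k) A PowerSeries.X ≠ 0)
    (htop : Ideal.span {algebraMap (PowerSeries k) A PowerSeries.X} ≠ ⊤) (d : ℕ)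
    (hd : Algebra.trdeg (PowerSeries k) A = d) : ringKrullDim A = (d + 1 : ℕ) := by
  apply le_antisymm
  · refine (ringKrullDim_le_iff_isMaximal_height_le _).mpr fun m hm ↦ ?_
    by_cases hXm : algebraMap (PowerSeries k) A PowerSeries.X ∈ m
    · rw [Ideal.height_eq_trdeg_add_one_of_isMaximal hX hXm d hd]
      simp
    · have : FaithfulSMul (PowerSeries k) A := by
        rw [faithfulSMul_iff_algebraMap_injective, RingHom.injective_iff_ker_eq_bot]
        exact Ideal.under_eq_bot_of_powerSeriesX_notMem ⊥ (by simpa using hX)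
      have h := m.height_le_trdeg_of_under_eq_bot
        (Ideal.under_eq_bot_of_powerSeriesX_notMem m hXm) d hd
      exact_mod_cast h.trans (by exact_mod_cast d.le_succ)
  · obtain ⟨m, hm, hle⟩ := Ideal.exists_le_maximal _ htop
    have h := Ideal.height_le_ringKrullDim_of_ne_top hm.ne_top
    rw [Ideal.height_eq_trdeg_add_one_of_isMaximal hX
      ((Ideal.span_singleton_le_iff_mem m).mp hle) d hd] at h
    exact_mod_cast h

theorem ringKrullDim_quotient_eq_trdeg_of_mem_minimalPrimes
    (hX : algebraMap (PowerSeries k) A PowerSeries.X ≠ 0) {p : Ideal A}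
    (hp : p ∈ (Ideal.span {algebraMap (PowerSeries k) A PowerSeries.X}).minimalPrimes) (d : ℕ)
    (hd : Algebra.trdeg (PowerSeries k) A = d) : ringKrullDim (A ⧸ p) = d := by
  classical
  have : IsNoetherianRing A := Algebra.FiniteType.isNoetherianRing (PowerSeries k) A
  have := hp.isPrime
  have hXp := (Ideal.span_singleton_le_iff_mem p).mp hp.1.2
  refine le_antisymm (ringKrullDim_quotient_le_of_powerSeriesX_mem hX hXp d hd) ?_
  have : Algebra.FiniteType k (A ⧸ p) := .quotient_of_powerSeriesX_mem p hXp
  have : IsJacobsonRing (A ⧸ p) := isJacobsonRing_of_finiteType (A := k)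
  let T := (Ideal.span {algebraMap (PowerSeries k) A
    PowerSeries.X}).finite_minimalPrimes_of_isNoetherianRing.toFinset.erase p
  obtain ⟨g, hgT, hgp⟩ : ∃ g ∈ T.inf id, g ∉ p := by
    refine SetLike.not_le_iff_exists.mp fun h ↦ ?_
    obtain ⟨q, hqT, hqp⟩ := (Ideal.IsPrime.inf_le' ‹_›).mp h
    simp only [T, Finset.mem_erase, Set.Finite.mem_toFinset] at hqT
    exact hqT.1 (le_antisymm hqp (hp.2 hqT.2.1 hqp))
  obtain ⟨M, hM, hgM⟩ : ∃ M : Ideal (A ⧸ p), M.IsMaximal ∧ Ideal.Quotient.mk p g ∉ M := by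
    by_contra! h
    refine hgp (Ideal.Quotient.eq_zero_iff_mem.mp ?_)
    have hjac := IsJacobsonRing.out ‹IsJacobsonRing (A ⧸ p)› Ideal.isPrime_bot.isRadical
    rw [← Ideal.mem_bot, ← hjac]
    exact Ideal.mem_sInf.mpr fun J hJ ↦ h J hJ.2
  have : (M.comap (Ideal.Quotient.mk p)).IsMaximal :=
    Ideal.comap_isMaximal_of_surjective _ Ideal.Quotient.mk_surjective
  have hpm : p ≤ M.comap (Ideal.Quotient.mk p) := fun a ha ↦ by
    simp [Ideal.Quotient.eq_zero_iff_mem.mpr ha]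
  have h := Ideal.le_height_map_quotientMk_of_isMaximal hpm hXp (fun q _ hqm hXq ↦ by
    obtain ⟨q', hq', hle⟩ :=
      Ideal.exists_minimalPrimes_le ((Ideal.span_singleton_le_iff_mem q).mpr hXq)
    obtain rfl | hne := eq_or_ne q' p
    · exact hle
    · have hgq : g ∈ q' := Finset.inf_le (f := id) (b := q') (by simp [T, hne, hq']) hgT
      exact absurd (hqm (hle hgq)) hgM) d hd
  rw [Ideal.map_comap_of_surjective _ Ideal.Quotient.mk_surjective] at h
  exact (WithBot.coe_le_coe.mpr h).trans (Ideal.height_le_ringKrullDim_of_ne_top hM.ne_top)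

end

theorem statement_9 {k : Type*} [Field k] {A : Type*} [CommRing A] [IsDomain A]
    [Algebra (PowerSeries k) A] [Algebra.FiniteType (PowerSeries k) A]
    [Algebra k A] [IsScalarTower k (PowerSeries k) A]
    (t' : A) (ht' : t' = algebraMap (PowerSeries k) A PowerSeries.X)
    (htne : t' ≠ 0) (htop : Ideal.span {t'} ≠ ⊤)
    (n : ℕ) (hn : ringKrullDim A = n) :
    (∀ p ∈ (Ideal.span {t'}).minimalPrimes, ∀ (hp : p.IsPrime),
      primeHeight p hp = 1 ∧ ringKrullDim (A ⧸ p) + 1 = (n : WithBot (WithTop ℕ))) ∧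
    (∀ (m : Ideal A) (hm : m.IsMaximal), t' ∈ m →
      primeHeight m hm.isPrime = (n : WithBot (WithTop ℕ)) ∧ Module.Finite k (A ⧸ m)) := by
  have : IsNoetherianRing A := Algebra.FiniteType.isNoetherianRing (PowerSeries k) A
  obtain ⟨d, hd⟩ := Cardinal.lt_aleph0.mp
    (trdeg_lt_aleph0_of_finiteType (R := PowerSeries k) (S := A))
  subst ht'
  obtain rfl : n = d + 1 := by
    rw [ringKrullDim_eq_trdeg_add_one htne htop d hd] at hn
    exact_mod_cast hn.symm
  refine ⟨fun p hpmin hp ↦ ⟨?_, ?_⟩, fun m hm hXm ↦ ⟨?_, ?_⟩⟩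
  · have hXp := (Ideal.span_singleton_le_iff_mem p).mp hpmin.1.2
    have hp0 : p.height ≠ 0 := fun h ↦ by
      rw [Ideal.height_eq_zero_iff_eq_bot] at h
      exact htne (by simpa [h] using hXp)
    rw [primeHeight, IsLocalization.AtPrime.ringKrullDim_eq_height p]
    exact congrArg _ (le_antisymm
      (Ideal.height_le_one_of_isPrincipal_of_mem_minimalPrimes _ p hpmin)
      (Order.one_le_iff_pos.mpr (pos_iff_ne_zero.mpr hp0)))
  · rw [ringKrullDim_quotient_eq_trdeg_of_mem_minimalPrimes htne hpmin d hd]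
    rfl
  · rw [primeHeight, IsLocalization.AtPrime.ringKrullDim_eq_height m,
      Ideal.height_eq_trdeg_add_one_of_isMaximal htne hXm d hd]
    rfl
  · have : Algebra.FiniteType k (A ⧸ m) := .quotient_of_powerSeriesX_mem m hXm
    let := Ideal.Quotient.field m
    exact finite_of_finite_type_of_isJacobsonRing k (A ⧸ m)
end
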